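/- Let X be a graph-directed Bedford–McMullen (×m,×n)-carpet. Assume the rectangular open set condition holds (for every v ∈ V the sets ψ_e((0,1)²), e ∈ E with i(e) = v, are pairwise disjoint subsets of (0,1)²) and that the adjacency matrix A of G is irreducible. Then dim_A X = dim_B π(X) + (1/log n) · lim_{k→∞} (1/k) log max_{y₁,...,y_k ∈ {0,...,m−1}} ‖A_{y₁}⋯A_{y_k}‖, where ‖·‖ is any matrix norm. -/

import Mathlib

open Set Filter Topology Metric
open scoped Classical

noncomputable section

/-- Least cardinality of a finite set of centers of closed balls of radius `r` covering `E`. -/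
def coverNum {X : Type*} [PseudoMetricSpace X] (r : ℝ) (E : Set X) : ℕ :=
  sInf {k : ℕ | ∃ S : Finset X, S.card = k ∧ E ⊆ ⋃ x ∈ S, Metric.closedBall x r}

/-- Upper box (Minkowski) dimension. -/
def upperBoxDim {X : Type*} [PseudoMetricSpace X] (E : Set X) : ℝ :=
  limsup (fun r : ℝ => Real.log (coverNum r E) / Real.log (1 / r)) (𝓝[>] (0 : ℝ))

/-- Lower box (Minkowski) dimension. -/
def lowerBoxDim {X : Type*} [PseudoMetricSpace X] (E : Set X) : ℝ :=
  liminf (fun r : ℝ => Real.log (coverNum r E) / Real.log (1 / r)) (𝓝[>] (0 : ℝ))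

/-- The box dimension (well-defined when `lowerBoxDim E = upperBoxDim E`). -/
def boxDim {X : Type*} [PseudoMetricSpace X] (E : Set X) : ℝ := upperBoxDim E

/-- Assouad dimension. -/
def assouadDim {X : Type*} [PseudoMetricSpace X] (E : Set X) : ℝ :=
  sInf {s : ℝ | 0 ≤ s ∧ ∃ C : ℝ, 0 < C ∧ ∀ x ∈ E, ∀ r R : ℝ,
    0 < r → r < R → R ≤ 1 →
    (coverNum r (E ∩ Metric.ball x R) : ℝ) ≤ C * (R / r) ^ s}

/-- Lower dimension. -/
def lowerDim {X : Type*} [PseudoMetricSpace X] (E : Set X) : ℝ :=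
  sSup {s : ℝ | 0 ≤ s ∧ ∃ C : ℝ, 0 < C ∧ ∀ x ∈ E, ∀ r R : ℝ,
    0 < r → r < R → R ≤ 1 →
    C * (R / r) ^ s ≤ (coverNum r (E ∩ Metric.ball x R) : ℝ)}

/-- A graph-directed Bedford–McMullen `(×m,×n)`-carpet family: a finite directed graph
`(V, E)` (loops and multiple edges allowed) in which every vertex emits an edge, each edge
carrying a digit pair `(x_e, y_e) ∈ {0,…,n−1} × {0,…,m−1}`, together with the unique family
of nonempty compact attractors `X v ⊆ [0,1]²` satisfying
`X v = ⋃_{e : src e = v} ψ_e (X (tgt e))` where `ψ_e (ξ₁, ξ₂) = ((ξ₁+x_e)/n, (ξ₂+y_e)/m)`. -/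
structure GDBMCarpet where
  m : ℕ
  n : ℕ
  hm : 2 ≤ m
  hmn : m < n
  V : Type
  E : Type
  fintypeV : Fintype V
  fintypeE : Fintype E
  decV : DecidableEq V
  decE : DecidableEq E
  src : E → V
  tgt : E → V
  xd : E → Fin n
  yd : E → Fin m
  src_surj : ∀ v : V, ∃ e : E, src e = v
  X : V → Set (ℝ × ℝ)
  X_nonempty : ∀ v, (X v).Nonempty
  X_compact : ∀ v, IsCompact (X v)
  X_subset : ∀ v, X v ⊆ Set.Icc (0 : ℝ) 1 ×ˢ Set.Icc (0 : ℝ) 1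
  X_invariant : ∀ v, X v =
    ⋃ e ∈ {e : E | src e = v},
      (fun p : ℝ × ℝ => ((p.1 + (xd e : ℝ)) / n, (p.2 + (yd e : ℝ)) / m)) '' X (tgt e)

attribute [instance] GDBMCarpet.fintypeV GDBMCarpet.fintypeE GDBMCarpet.decV GDBMCarpet.decE

namespace GDBMCarpet

variable (S : GDBMCarpet)

/-- The contraction `ψ_e`. -/
def psi (e : S.E) : ℝ × ℝ → ℝ × ℝ :=
  fun p => ((p.1 + (S.xd e : ℝ)) / S.n, (p.2 + (S.yd e : ℝ)) / S.m)

/-- The projected contraction `φ_e` on the second coordinate axis. -/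
def phi (e : S.E) : ℝ → ℝ := fun t => (t + (S.yd e : ℝ)) / S.m

/-- The carpet `X = ⋃_{v ∈ V} X_v`. -/
def Xunion : Set (ℝ × ℝ) := ⋃ v : S.V, S.X v

/-- The projection `π(ξ₁,ξ₂) = ξ₂` onto the second coordinate axis. -/
def proj : ℝ × ℝ → ℝ := Prod.snd

/-- The open unit square `(0,1)²`. -/
def openSquare : Set (ℝ × ℝ) := Set.Ioo (0 : ℝ) 1 ×ˢ Set.Ioo (0 : ℝ) 1

/-- `w : Fin k → E` is an admissible word along the graph. -/
def IsWord (k : ℕ) (w : Fin k → S.E) : Prop :=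
  ∀ (i : ℕ) (h : i + 1 < k), S.tgt (w ⟨i, Nat.lt_of_succ_lt h⟩) = S.src (w ⟨i + 1, h⟩)

/-- The word `w` has initial vertex `v` (vacuous for the empty word). -/
def wordStart (k : ℕ) (w : Fin k → S.E) (v : S.V) : Prop :=
  ∀ h : 0 < k, S.src (w ⟨0, h⟩) = v

/-- The terminal vertex `t(w)` of a nonempty word. -/
def wordEnd {k : ℕ} (hk : 0 < k) (w : Fin k → S.E) : S.V :=
  S.tgt (w ⟨k - 1, Nat.sub_lt hk one_pos⟩)

/-- `ψ_w = ψ_{w₁} ∘ ⋯ ∘ ψ_{w_k}`. -/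
def psiWord (k : ℕ) (w : Fin k → S.E) : ℝ × ℝ → ℝ × ℝ :=
  (List.ofFn (fun i => S.psi (w i))).foldr (· ∘ ·) id

/-- `φ_w = φ_{w₁} ∘ ⋯ ∘ φ_{w_k}`. -/
def phiWord (k : ℕ) (w : Fin k → S.E) : ℝ → ℝ :=
  (List.ofFn (fun i => S.phi (w i))).foldr (· ∘ ·) id

/-- `η(v,x,y) = dim_B π(X_v ∩ ψ_w((0,1)²))` if some admissible word `w` with `i(w) = v`
has digit strings `(x, y)`, and `0` otherwise.  (The set `ψ_w((0,1)²)` depends only on the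
digit strings, so the choice of witness is immaterial.) -/
def eta (v : S.V) (k : ℕ) (x : Fin k → Fin S.n) (y : Fin k → Fin S.m) : ℝ :=
  if h : ∃ w : Fin k → S.E, S.IsWord k w ∧ S.wordStart k w v ∧
      (∀ i, S.xd (w i) = x i) ∧ (∀ i, S.yd (w i) = y i) then
    boxDim (GDBMCarpet.proj '' (S.X v ∩ S.psiWord k h.choose '' GDBMCarpet.openSquare))
  else 0

/-- The open interval `I_{y'}` associated with a finite word `y'` over `Σ_Y`. -/
def Iy (l : ℕ) (y : Fin l → Fin S.m) : Set ℝ :=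
  Set.Ioo (∑ i : Fin l, (y i : ℝ) / (S.m : ℝ) ^ ((i : ℕ) + 1))
    ((∑ i : Fin l, (y i : ℝ) / (S.m : ℝ) ^ ((i : ℕ) + 1)) + 1 / (S.m : ℝ) ^ l)

/-- `θ(v, x, y, y')`:  equals `η(v,x,y)` when `y' = ∅`, and equals
`dim_B (π(X_v ∩ ψ_w((0,1)²)) ∩ φ_w(I_{y'}))` when `y' ≠ ∅` (with `0` when no witness
word exists). -/
def theta (v : S.V) (k : ℕ) (x : Fin k → Fin S.n) (y : Fin k → Fin S.m)
    (l : ℕ) (y' : Fin l → Fin S.m) : ℝ :=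
  if l = 0 then S.eta v k x y
  else if h : ∃ w : Fin k → S.E, S.IsWord k w ∧ S.wordStart k w v ∧
      (∀ i, S.xd (w i) = x i) ∧ (∀ i, S.yd (w i) = y i) then
    boxDim ((GDBMCarpet.proj '' (S.X v ∩ S.psiWord k h.choose '' GDBMCarpet.openSquare)) ∩
      S.phiWord k h.choose '' S.Iy l y')
  else 0

/-- `Ṽ`: vertices that are terminal vertices of admissible words of length at least `#V`. -/
def Vtilde : Set S.V :=
  {v | ∃ (k : ℕ) (hk : 0 < k), Fintype.card S.V ≤ k ∧
    ∃ w : Fin k → S.E, S.IsWord k w ∧ S.wordEnd hk w = v}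

/-- The `x`-digit strings realized by admissible words of length `k` starting from `v`
with `y`-digit string `y`; these index the equivalence classes `[w] ∈ [E^k]` with
`i(w) = v` and `y_w = y` (a class is determined by its digit strings). -/
def realizedX (v : S.V) (k : ℕ) (y : Fin k → Fin S.m) : Finset (Fin k → Fin S.n) :=
  Finset.univ.filter (fun x => ∃ w : Fin k → S.E, S.IsWord k w ∧ S.wordStart k w v ∧
    (∀ i, S.xd (w i) = x i) ∧ (∀ i, S.yd (w i) = y i))

/-- The digit-string pairs realized by admissible words of length `k` from `v`; these
index the classes `[w]` with `w ∈ E^k`, `i(w) = v`. -/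
def realizedXY (v : S.V) (k : ℕ) : Finset ((Fin k → Fin S.n) × (Fin k → Fin S.m)) :=
  Finset.univ.filter (fun xy => ∃ w : Fin k → S.E, S.IsWord k w ∧ S.wordStart k w v ∧
    (∀ i, S.xd (w i) = xy.1 i) ∧ (∀ i, S.yd (w i) = xy.2 i))

/-- `α_k = max_{v∈Ṽ} max_{y∈Σ_Y^k} Σ_{[w]∈[E^k] : i(w)=v, y_w=y} n^{k·η(v,x_w,y_w)}`. -/
def alphaSeq (k : ℕ) : ℝ :=
  ⨆ v ∈ S.Vtilde, ⨆ y : Fin k → Fin S.m,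
    ∑ x ∈ S.realizedX v k y, (S.n : ℝ) ^ ((k : ℝ) * S.eta v k x y)

/-- `τ_k = max_{v ∈ V} #{[w] : w ∈ E^k, i(w) = v}`. -/
def tauSeq (k : ℕ) : ℕ :=
  Finset.univ.sup (fun v : S.V => (S.realizedXY v k).card)

/-- `t([w])`: the set of terminal vertices of words equivalent to `w` (words with the
same digit strings). -/
def termSet (k : ℕ) (hk : 0 < k) (w : Fin k → S.E) : Set S.V :=
  {v | ∃ w' : Fin k → S.E, S.IsWord k w' ∧ (∀ i, S.xd (w' i) = S.xd (w i)) ∧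
    (∀ i, S.yd (w' i) = S.yd (w i)) ∧ S.wordEnd hk w' = v}

/-- The inner collection in the definition of `β_k`. -/
def betaInner (v : S.V) (k : ℕ) : Set ℝ :=
  {c | ∃ (y : Fin k → Fin S.m) (l : ℕ) (y' : Fin l → Fin S.m),
    (0 < ∑ x ∈ S.realizedX v k y, S.theta v k x y l y') ∧
    c = ∑ x ∈ S.realizedX v k y,
      (if 0 < S.theta v k x y l y' then (S.n : ℝ) ^ ((k : ℝ) * S.theta v k x y l y') else 0)}

/-- `β_k`. -/
def betaSeq (k : ℕ) : ℝ :=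
  sInf {b | ∃ (l : ℕ) (hl : 0 < l) (w : Fin l → S.E),
    Fintype.card S.V ≤ l ∧ S.IsWord l w ∧
    b = ⨆ v ∈ S.termSet l hl w, sInf (S.betaInner v k)}

/-- `β = liminf_{k→∞} (β_k)^{1/k}`. -/
def betaVal : ℝ := liminf (fun k : ℕ => (S.betaSeq k) ^ ((k : ℝ)⁻¹)) atTop

/-- `l = ⌊k·log_n m⌋`, so that `n^l ≤ m^k < n^{l+1}`. -/
def lvl (k : ℕ) : ℕ := Nat.floor ((k : ℝ) * Real.logb S.n S.m)

/-- The approximate square `Q_k(p,q) = [p/n^l, (p+1)/n^l] × [q/m^k, (q+1)/m^k]`. -/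
def approxSq (k : ℕ) (p q : ℤ) : Set (ℝ × ℝ) :=
  Set.Icc ((p : ℝ) / (S.n : ℝ) ^ S.lvl k) (((p : ℝ) + 1) / (S.n : ℝ) ^ S.lvl k) ×ˢ
  Set.Icc ((q : ℝ) / (S.m : ℝ) ^ k) (((q : ℝ) + 1) / (S.m : ℝ) ^ k)

/-- `N_k(F)` for `F ⊆ ℝ²`: least number of level-`k` approximate squares covering `F`. -/
def NkSq (k : ℕ) (F : Set (ℝ × ℝ)) : ℕ :=
  sInf {c : ℕ | ∃ T : Finset (ℤ × ℤ), T.card = c ∧ F ⊆ ⋃ pq ∈ T, S.approxSq k pq.1 pq.2}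

/-- `N_k(F)` for `F ⊆ ℝ`: least number of intervals `[i/m^k, (i+1)/m^k]` covering `F`. -/
def NkInt (k : ℕ) (F : Set ℝ) : ℕ :=
  sInf {c : ℕ | ∃ T : Finset ℤ, T.card = c ∧
    F ⊆ ⋃ i ∈ T, Set.Icc ((i : ℝ) / (S.m : ℝ) ^ k) (((i : ℝ) + 1) / (S.m : ℝ) ^ k)}

/-- The adjacency matrix `A` of `G`. -/
def adjMat : Matrix S.V S.V ℕ :=
  fun v v' => (Finset.univ.filter (fun e : S.E => S.src e = v ∧ S.tgt e = v')).card

/-- The matrices `A_j`, `0 ≤ j < m`, with `A_j(v,v') = #{e : v →e v', y_e = j}` (real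
entries). -/
def Amat (j : Fin S.m) : Matrix S.V S.V ℝ :=
  fun v v' =>
    ((Finset.univ.filter (fun e : S.E => S.src e = v ∧ S.tgt e = v' ∧ S.yd e = j)).card : ℝ)

/-- `G` is irreducible: `Σ_{j ≥ 1} A^j` is positive. -/
def GraphIrreducible : Prop :=
  ∀ v v' : S.V, ∃ k : ℕ, 0 < k ∧ 0 < (S.adjMat ^ k) v v'

/-- The rectangular open set condition. -/
def ROSC : Prop :=
  ∀ v : S.V, (∀ e : S.E, S.src e = v → S.psi e '' GDBMCarpet.openSquare ⊆ GDBMCarpet.openSquare) ∧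
    ∀ e e' : S.E, S.src e = v → S.src e' = v → e ≠ e' →
      Disjoint (S.psi e '' GDBMCarpet.openSquare) (S.psi e' '' GDBMCarpet.openSquare)

/-- The words `I^k` of length `k` appearing in the symbolic space `I ⊆ (Σ_X × Σ_Y)^ℕ`. -/
def Ik (k : ℕ) : Finset (Fin k → Fin S.n × Fin S.m) :=
  Finset.univ.filter (fun f => ∃ w : Fin k → S.E, S.IsWord k w ∧
    ∀ i, (S.xd (w i), S.yd (w i)) = f i)

/-- The words `(πI)^k` of length `k` appearing in `πI ⊆ Σ_Y^ℕ`. -/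
def piIk (k : ℕ) : Finset (Fin k → Fin S.m) :=
  Finset.univ.filter (fun y => ∃ w : Fin k → S.E, S.IsWord k w ∧ ∀ i, S.yd (w i) = y i)

/-- `h_top(I) = lim_k (1/k) log #I^k`. -/
def hTopI : ℝ := limsup (fun k : ℕ => Real.log (S.Ik k).card / (k : ℝ)) atTop

/-- `h_top(πI) = lim_k (1/k) log #(πI)^k`. -/
def hTopPiI : ℝ := limsup (fun k : ℕ => Real.log (S.piIk k).card / (k : ℝ)) atTop

/-- The symbolic projection space `πI ⊆ Σ_Y^ℕ`. -/
def piI : Set (ℕ → Fin S.m) :=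
  {y | ∃ ω : ℕ → S.E, (∀ i, S.tgt (ω i) = S.src (ω (i + 1))) ∧ ∀ i, S.yd (ω i) = y i}

/-- The `x`-strings of length-`k` words lying over `y|_k`. -/
def fiberXk (y : ℕ → Fin S.m) (k : ℕ) : Finset (Fin k → Fin S.n) :=
  Finset.univ.filter (fun x => ∃ w : Fin k → S.E, S.IsWord k w ∧
    (∀ i : Fin k, S.yd (w i) = y (i : ℕ)) ∧ ∀ i, S.xd (w i) = x i)

/-- `h_top(π⁻¹(y)) = limsup_k (1/k) log #{x_w : w ∈ E^k, y_w = y|_k}`. -/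
def hTopFiber (y : ℕ → Fin S.m) : ℝ :=
  limsup (fun k : ℕ => Real.log (S.fiberXk y k).card / (k : ℝ)) atTop

/-- Words staying within the subgraph spanned by the vertex set `W`. -/
def InWord (W : Set S.V) (k : ℕ) (w : Fin k → S.E) : Prop :=
  S.IsWord k w ∧ ∀ i, S.src (w i) ∈ W ∧ S.tgt (w i) ∈ W

/-- There is a directed path inside `W` from `v` to `v'`. -/
def PathIn (W : Set S.V) (v v' : S.V) : Prop :=
  ∃ (k : ℕ) (hk : 0 < k) (w : Fin k → S.E), S.InWord W k w ∧
    S.src (w ⟨0, hk⟩) = v ∧ S.wordEnd hk w = v'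

/-- The subgraph spanned by `W` is irreducible. -/
def IsIrred (W : Set S.V) : Prop :=
  W.Nonempty ∧ ∀ v ∈ W, ∀ v' ∈ W, S.PathIn W v v'

/-- `W` spans an irreducible component of `G` (a maximal irreducible subgraph). -/
def IsIrredComponent (W : Set S.V) : Prop :=
  S.IsIrred W ∧ ∀ W' : Set S.V, W ⊆ W' → S.IsIrred W' → W' = W

/-- There is a directed path in `G` from a vertex of `W` to a vertex of `W'`
(defining `{i}⁺`). -/
def Reaches (W W' : Set S.V) : Prop :=
  ∃ v ∈ W, ∃ v' ∈ W', S.PathIn Set.univ v v'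

/-- `(I_H)^k` for the subgraph spanned by `W`. -/
def IkIn (W : Set S.V) (k : ℕ) : Finset (Fin k → Fin S.n × Fin S.m) :=
  Finset.univ.filter (fun f => ∃ w : Fin k → S.E, S.InWord W k w ∧
    ∀ i, (S.xd (w i), S.yd (w i)) = f i)

/-- `(πI_H)^k` for the subgraph spanned by `W`. -/
def piIkIn (W : Set S.V) (k : ℕ) : Finset (Fin k → Fin S.m) :=
  Finset.univ.filter (fun y => ∃ w : Fin k → S.E, S.InWord W k w ∧ ∀ i, S.yd (w i) = y i)

/-- `h_top(I_H)`. -/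
def hTopIIn (W : Set S.V) : ℝ :=
  limsup (fun k : ℕ => Real.log (S.IkIn W k).card / (k : ℝ)) atTop

/-- `h_top(πI_H)`. -/
def hTopPiIIn (W : Set S.V) : ℝ :=
  limsup (fun k : ℕ => Real.log (S.piIkIn W k).card / (k : ℝ)) atTop

/-- `πI_H` for the subgraph spanned by `W`. -/
def piIIn (W : Set S.V) : Set (ℕ → Fin S.m) :=
  {y | ∃ ω : ℕ → S.E, (∀ i, S.tgt (ω i) = S.src (ω (i + 1))) ∧
    (∀ i, S.src (ω i) ∈ W ∧ S.tgt (ω i) ∈ W) ∧ ∀ i, S.yd (ω i) = y i}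

/-- The `x`-strings of length-`k` words of the subgraph spanned by `W` lying over `y|_k`. -/
def fiberXkIn (W : Set S.V) (y : ℕ → Fin S.m) (k : ℕ) : Finset (Fin k → Fin S.n) :=
  Finset.univ.filter (fun x => ∃ w : Fin k → S.E, S.InWord W k w ∧
    (∀ i : Fin k, S.yd (w i) = y (i : ℕ)) ∧ ∀ i, S.xd (w i) = x i)

/-- `h_top(π⁻¹(y) ∩ I_H)`. -/
def hTopFiberIn (W : Set S.V) (y : ℕ → Fin S.m) : ℝ :=
  limsup (fun k : ℕ => Real.log (S.fiberXkIn W y k).card / (k : ℝ)) atTop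

end GDBMCarpet

section Growth

theorem exists_le_rpow_of_tendsto {u : ℕ → ℝ} {l b t : ℝ} (hb : 1 < b)
    (hu : Tendsto (fun k : ℕ => 1 / (k : ℝ) * Real.log (u k)) atTop (𝓝 l))
    (ht : l / Real.log b < t) :
    ∃ C : ℝ, 0 < C ∧ ∀ k, u k ≤ C * (b ^ k) ^ t := by
  have hlog : 0 < Real.log b := Real.log_pos hb
  have hb0 : 0 < b := by linarith
  have hlt : l < t * Real.log b := by rwa [div_lt_iff₀ hlog] at ht
  obtain ⟨k₀, hk₀⟩ := eventually_atTop.1 (hu.eventually (gt_mem_nhds hlt))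
  have hpos : ∀ k : ℕ, 0 < (b ^ k) ^ t := fun k => by positivity
  refine ⟨1 + ∑ i ∈ Finset.range (k₀ + 1), |u i| / (b ^ i) ^ t,
    by have : 0 ≤ ∑ i ∈ Finset.range (k₀ + 1), |u i| / (b ^ i) ^ t :=
        Finset.sum_nonneg fun i _ => by positivity
       linarith, fun k => ?_⟩
  by_cases hk : k < k₀ + 1
  · have h1 : |u k| / (b ^ k) ^ t ≤ ∑ i ∈ Finset.range (k₀ + 1), |u i| / (b ^ i) ^ t :=
      Finset.single_le_sum (f := fun i => |u i| / (b ^ i) ^ t)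
        (fun i _ => by positivity) (Finset.mem_range.2 hk)
    calc u k ≤ |u k| := le_abs_self _
      _ = |u k| / (b ^ k) ^ t * (b ^ k) ^ t := by field_simp
      _ ≤ _ := by gcongr; linarith
  · have hk' : (0 : ℝ) < k := by exact_mod_cast (by omega : 0 < k)
    have h1 := hk₀ k (by omega)
    have h2 : Real.log (u k) ≤ t * Real.log b * k := by
      rw [one_div, inv_mul_lt_iff₀ hk'] at h1
      nlinarith
    calc u k ≤ Real.exp (Real.log (u k)) := Real.le_exp_log _
      _ ≤ Real.exp (t * Real.log b * k) := Real.exp_le_exp.2 h2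
      _ = (b ^ k) ^ t := by
        rw [Real.rpow_def_of_pos (by positivity), Real.log_pow]; ring_nf
      _ ≤ _ := by
        refine le_mul_of_one_le_left (hpos k).le ?_
        have : 0 ≤ ∑ i ∈ Finset.range (k₀ + 1), |u i| / (b ^ i) ^ t :=
          Finset.sum_nonneg fun i _ => by positivity
        linarith

theorem eventually_rpow_le_of_tendsto {u : ℕ → ℝ} {l b t : ℝ} (hb : 1 < b)
    (hpos : ∀ k, 0 < u k)
    (hu : Tendsto (fun k : ℕ => 1 / (k : ℝ) * Real.log (u k)) atTop (𝓝 l))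
    (ht : t < l / Real.log b) :
    ∀ᶠ k : ℕ in atTop, (b ^ k) ^ t ≤ u k := by
  have hlog : 0 < Real.log b := Real.log_pos hb
  have hb0 : 0 < b := by linarith
  have hlt : t * Real.log b < l := by rwa [lt_div_iff₀ hlog] at ht
  filter_upwards [hu.eventually (lt_mem_nhds hlt), eventually_gt_atTop 0] with k h1 hk
  have hk' : (0 : ℝ) < k := by exact_mod_cast hk
  have h2 : t * Real.log b * k ≤ Real.log (u k) := by
    rw [one_div, lt_inv_mul_iff₀ hk'] at h1
    nlinarith
  calc (b ^ k) ^ t = Real.exp (t * Real.log b * k) := by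
        rw [Real.rpow_def_of_pos (by positivity), Real.log_pow]; ring_nf
    _ ≤ Real.exp (Real.log (u k)) := Real.exp_le_exp.2 h2
    _ = u k := Real.exp_log (hpos k)

theorem le_of_eventually_mul_rpow_le {b c C s t : ℝ} (hb : 1 < b) (hc : 0 < c)
    (h : ∀ᶠ k : ℕ in atTop, c * (b ^ k) ^ t ≤ C * (b ^ k) ^ s) : t ≤ s := by
  by_contra! hst
  have hb0 : 0 < b := by linarith
  have hbt : 1 < b ^ (t - s) := Real.one_lt_rpow hb (by linarith)
  obtain ⟨k, hk, hk'⟩ := (h.and ((tendsto_pow_atTop_atTop_of_one_lt hbt).eventually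
    (eventually_gt_atTop (C / c)))).exists
  have h1 : (b ^ k) ^ t = (b ^ (t - s)) ^ k * (b ^ k) ^ s := by
    rw [← Real.rpow_natCast, ← Real.rpow_natCast, ← Real.rpow_mul hb0.le, ← Real.rpow_mul hb0.le,
      ← Real.rpow_mul hb0.le, ← Real.rpow_add hb0]
    ring_nf
  have h2 : 0 < (b ^ k) ^ s := by positivity
  rw [h1, ← mul_assoc] at hk
  have h3 := le_of_mul_le_mul_right hk h2
  rw [div_lt_iff₀ hc] at hk'
  linarith

end Growth

section Norms

theorem exists_norm_bounds {κ : Type*} [Fintype κ] (N : (κ → ℝ) → ℝ)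
    (hN0 : ∀ A, N A = 0 ↔ A = 0) (hNnonneg : ∀ A, 0 ≤ N A)
    (hNsmul : ∀ (c : ℝ) A, N (c • A) = |c| * N A)
    (hNadd : ∀ A B, N (A + B) ≤ N A + N B) :
    (∃ C : ℝ, 0 < C ∧ ∀ A i, |A i| ≤ C * N A) ∧
      ∃ C : ℝ, 0 < C ∧ ∀ A, N A ≤ C * ‖A‖ := by
  have hsum : ∀ (s : Finset κ) (f : κ → κ → ℝ), N (∑ i ∈ s, f i) ≤ ∑ i ∈ s, N (f i) := by
    intro s f
    induction s using Finset.induction_on with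
    | empty => simp [(hN0 0).2 rfl]
    | insert a s ha ih =>
      rw [Finset.sum_insert ha, Finset.sum_insert ha]
      linarith [hNadd (f a) (∑ i ∈ s, f i)]
  have hub : ∃ C : ℝ, 0 < C ∧ ∀ A, N A ≤ C * ‖A‖ := by
    have h0 : 0 ≤ ∑ i, N (Pi.single i 1) := Finset.sum_nonneg fun i _ => hNnonneg _
    refine ⟨1 + ∑ i, N (Pi.single i 1), by linarith, fun A => ?_⟩
    have hA : A = ∑ i, A i • (Pi.single i (1 : ℝ) : κ → ℝ) := by
      ext j; simp [Finset.sum_apply, Pi.single_apply]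
    calc N A = N (∑ i, A i • (Pi.single i (1 : ℝ) : κ → ℝ)) := by rw [← hA]
      _ ≤ ∑ i, N (A i • (Pi.single i (1 : ℝ) : κ → ℝ)) := hsum _ _
      _ ≤ ∑ i, ‖A‖ * N (Pi.single i 1) := by
        refine Finset.sum_le_sum fun i _ => ?_
        rw [hNsmul]
        exact mul_le_mul_of_nonneg_right (norm_le_pi_norm A i) (hNnonneg _)
      _ = (∑ i, N (Pi.single i 1)) * ‖A‖ := by rw [← Finset.mul_sum, mul_comm]
      _ ≤ _ := by gcongr; linarith
  refine ⟨?_, hub⟩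
  obtain ⟨C, hC, hCN⟩ := hub
  have hneg : ∀ A, N (-A) = N A := fun A => by
    have := hNsmul (-1) A
    simpa using this
  have hcont : Continuous N := by
    refine (LipschitzWith.of_dist_le_mul (K := C.toNNReal) fun A B => ?_).continuous
    rw [Real.coe_toNNReal _ hC.le, Real.dist_eq, dist_eq_norm, abs_le]
    have h1 := hNadd (A - B) B
    have h2 := hNadd (B - A) A
    have h3 := hneg (A - B)
    rw [neg_sub] at h3
    have h4 := hCN (A - B)
    simp only [sub_add_cancel] at h1 h2
    constructor <;> linarith
  by_cases hne : (sphere (0 : κ → ℝ) 1).Nonempty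
  · obtain ⟨A₀, hA₀, hmin⟩ := (isCompact_sphere (0 : κ → ℝ) 1).exists_isMinOn hne
      hcont.continuousOn
    have hA₀' : ‖A₀‖ = 1 := by simpa using hA₀
    have hpos : 0 < N A₀ := (hNnonneg _).lt_of_ne fun h => by
      rw [(hN0 A₀).1 h.symm] at hA₀'; simp at hA₀'
    refine ⟨(N A₀)⁻¹, by positivity, fun A i => ?_⟩
    refine (norm_le_pi_norm A i).trans ?_
    rcases eq_or_ne A 0 with rfl | hA
    · simp [(hN0 0).2 rfl]
    · have hA' : 0 < ‖A‖ := norm_pos_iff.2 hA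
      have h1 : N A₀ ≤ N (‖A‖⁻¹ • A) := hmin (by simp [norm_smul, hA'.ne'])
      rw [hNsmul, abs_of_pos (by positivity)] at h1
      rw [le_inv_mul_iff₀ hpos]
      rw [le_inv_mul_iff₀ hA'] at h1
      linarith
  · refine ⟨1, one_pos, fun A i => (hne ⟨fun _ => 1, ?_⟩).elim⟩
    have : Nonempty κ := ⟨i⟩
    simp

end Norms

section Covering

theorem coverNum_le_card {X : Type*} [PseudoMetricSpace X] {r : ℝ} {E : Set X} (T : Finset X)
    (h : E ⊆ ⋃ x ∈ T, closedBall x r) : coverNum r E ≤ T.card :=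
  Nat.sInf_le ⟨T, rfl, h⟩

theorem exists_card_eq_coverNum {X : Type*} [PseudoMetricSpace X] {r : ℝ} {E : Set X}
    (hE : TotallyBounded E) (hr : 0 < r) :
    ∃ T : Finset X, T.card = coverNum r E ∧ E ⊆ ⋃ x ∈ T, closedBall x r := by
  refine Nat.sInf_mem (s := {k : ℕ | ∃ T : Finset X, T.card = k ∧ E ⊆ ⋃ x ∈ T, closedBall x r}) ?_
  obtain ⟨t, ht, hEt⟩ := Metric.totallyBounded_iff.1 hE r hr
  refine ⟨_, ht.toFinset, rfl, hEt.trans ?_⟩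
  simp only [Set.Finite.mem_toFinset]
  exact Set.iUnion₂_mono fun x _ => ball_subset_closedBall

/-- If each closed `r`-ball contains at most `c` of the marked points, then the number of
marked points is at most `c` times the covering number. -/
theorem card_le_mul_coverNum {X ι : Type*} [PseudoMetricSpace X] {r : ℝ} {E : Set X}
    (hE : TotallyBounded E) (hr : 0 < r) (I : Finset ι) (f : ι → X) (hf : ∀ i ∈ I, f i ∈ E)
    (c : ℕ) (hc : ∀ x, (I.filter fun i => f i ∈ closedBall x r).card ≤ c) :
    I.card ≤ c * coverNum r E := by
  obtain ⟨T, hT, hET⟩ := exists_card_eq_coverNum hE hr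
  have hsub : I ⊆ T.biUnion fun x => I.filter fun i => f i ∈ closedBall x r := by
    intro i hi
    obtain ⟨x, hx, hix⟩ := Set.mem_iUnion₂.1 (hET (hf i hi))
    exact Finset.mem_biUnion.2 ⟨x, hx, Finset.mem_filter.2 ⟨hi, hix⟩⟩
  rw [← hT, mul_comm]
  exact (Finset.card_le_card hsub).trans (Finset.card_biUnion_le_card_mul _ _ _ fun x _ => hc x)

theorem card_le_four {s : Finset ℕ} {t : ℝ} (h : ∀ b ∈ s, t - 2 ≤ b ∧ (b : ℝ) ≤ t + 1) :
    s.card ≤ 4 := by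
  have h1 : s.map Nat.castEmbedding ⊆ Finset.Icc (⌈t - 2⌉ : ℤ) ⌊t + 1⌋ := by
    intro z hz
    obtain ⟨b, hb, rfl⟩ := Finset.mem_map.1 hz
    rw [Finset.mem_Icc]
    exact ⟨Int.ceil_le.2 (by simpa using (h b hb).1), Int.le_floor.2 (by simpa using (h b hb).2)⟩
  have h2 := Finset.card_le_card h1
  rw [Finset.card_map, Int.card_Icc] at h2
  have h3 : (⌊t + 1⌋ : ℝ) ≤ t + 1 := Int.floor_le _
  have h4 : t - 2 ≤ (⌈t - 2⌉ : ℝ) := Int.le_ceil _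
  have h5 : ⌊t + 1⌋ - ⌈t - 2⌉ ≤ 3 := by
    have : ((⌊t + 1⌋ - ⌈t - 2⌉ : ℤ) : ℝ) ≤ 3 := by push_cast; linarith
    exact_mod_cast this
  omega

end Covering

section Digits

/-- The integer with base-`b` digit string `l`, most significant digit first. -/
def digitValue {b : ℕ} : List (Fin b) → ℕ
  | [] => 0
  | d :: l => d * b ^ l.length + digitValue l

theorem digitValue_lt {b : ℕ} (l : List (Fin b)) : digitValue l < b ^ l.length := by
  induction l with
  | nil => simp [digitValue]
  | cons d l ih =>
    rw [digitValue, List.length_cons, pow_succ']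
    have : (d + 1) * b ^ l.length ≤ b * b ^ l.length := Nat.mul_le_mul_right _ d.2
    linarith

theorem digitValue_injective {b : ℕ} {l l' : List (Fin b)} (hlen : l.length = l'.length)
    (h : digitValue l = digitValue l') : l = l' := by
  induction l generalizing l' with
  | nil => exact (List.length_eq_zero_iff.1 hlen.symm).symm
  | cons d l ih =>
    obtain _ | ⟨d', l'⟩ := l'
    · simp at hlen
    have hlen' : l.length = l'.length := by simpa using hlen
    simp only [digitValue, ← hlen'] at h
    have hl := digitValue_lt l
    have hl' := digitValue_lt l'
    rw [← hlen'] at hl'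
    have hpos : 0 < b ^ l.length := by omega
    have hd : (d : ℕ) = d' := by
      have := congrArg (· / b ^ l.length) h
      simpa [Nat.mul_add_div, Nat.add_div, mul_comm _ (b ^ l.length), hpos,
        Nat.mul_add_div hpos, Nat.div_eq_of_lt hl, Nat.div_eq_of_lt hl'] using this
    rw [hd] at h
    rw [Fin.ext hd, ih hlen' (by omega)]

end Digits

namespace GDBMCarpet

variable (S : GDBMCarpet)

theorem n_pos : 0 < S.n := by have := S.hm; have := S.hmn; omega

theorem m_pos : 0 < S.m := by have := S.hm; omega

theorem one_lt_m : (1 : ℝ) < S.m := by exact_mod_cast S.hm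

theorem one_lt_n : (1 : ℝ) < S.n := S.one_lt_m.trans (by exact_mod_cast S.hmn)

/-- `w` is the edge sequence of a directed path from `v` to `v'`. -/
def IsPath : S.V → List S.E → S.V → Prop
  | v, [], v' => v = v'
  | v, e :: w, v' => S.src e = v ∧ IsPath (S.tgt e) w v'

variable {S}

theorem isPath_append {v v' : S.V} {w w' : List S.E} :
    S.IsPath v (w ++ w') v' ↔ ∃ u, S.IsPath v w u ∧ S.IsPath u w' v' := by
  induction w generalizing v with
  | nil => simp [IsPath]
  | cons e w ih => simp [IsPath, ih, and_assoc]

theorem exists_isPath_from (v : S.V) (k : ℕ) : ∃ w v', S.IsPath v w v' ∧ w.length = k := by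
  induction k generalizing v with
  | zero => exact ⟨[], v, rfl, rfl⟩
  | succ k ih =>
    obtain ⟨e, he⟩ := S.src_surj v
    obtain ⟨w, v', hw, hl⟩ := ih (S.tgt e)
    exact ⟨e :: w, v', ⟨he, hw⟩, by simp [hl]⟩

theorem exists_isPath_of_adjMat_pow_pos {k : ℕ} {v v' : S.V} (h : 0 < (S.adjMat ^ k) v v') :
    ∃ w, S.IsPath v w v' ∧ w.length = k := by
  induction k generalizing v with
  | zero =>
    refine ⟨[], ?_, rfl⟩
    by_contra hne
    have hne' : v ≠ v' := hne
    simp [Matrix.one_apply_ne hne'] at h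
  | succ k ih =>
    rw [pow_succ', Matrix.mul_apply] at h
    obtain ⟨u, -, hu⟩ := Finset.exists_ne_zero_of_sum_ne_zero h.ne'
    obtain ⟨h1, h2⟩ := Nat.mul_ne_zero_iff.1 hu
    obtain ⟨e, he⟩ := Finset.card_pos.1 (Nat.pos_of_ne_zero h1)
    obtain ⟨w, hw, hl⟩ := ih (Nat.pos_of_ne_zero h2)
    simp only [Finset.mem_filter, Finset.mem_univ, true_and] at he
    exact ⟨e :: w, ⟨he.1, he.2 ▸ hw⟩, by simp [hl]⟩

theorem exists_isPath_to (hirr : S.GraphIrreducible) (v : S.V) (k : ℕ) :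
    ∃ w v', S.IsPath v' w v ∧ w.length = k := by
  induction k with
  | zero => exact ⟨[], v, rfl, rfl⟩
  | succ k ih =>
    obtain ⟨w, u, hw, hl⟩ := ih
    obtain ⟨j, hj, hpos⟩ := hirr u u
    obtain ⟨q, hq, hql⟩ := exists_isPath_of_adjMat_pow_pos hpos
    obtain ⟨q', e, rfl⟩ := List.eq_nil_or_concat' q |>.resolve_left (by
      rintro rfl; simp at hql; omega)
    obtain ⟨u', -, hu'⟩ := isPath_append.1 hq
    exact ⟨e :: w, u', ⟨hu'.1, by rw [show S.tgt e = u from hu'.2]; exact hw⟩, by simp [hl]⟩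

variable (S) in
/-- The image of a point under the composed contraction along the edge sequence `w`. -/
def code (w : List S.E) (z : ℝ × ℝ) : ℝ × ℝ :=
  ((z.1 + digitValue (w.map S.xd)) / (S.n : ℝ) ^ w.length,
    (z.2 + digitValue (w.map S.yd)) / (S.m : ℝ) ^ w.length)

theorem code_cons (e : S.E) (w : List S.E) (z : ℝ × ℝ) :
    S.code (e :: w) z = (((S.code w z).1 + (S.xd e : ℝ)) / S.n,
      ((S.code w z).2 + (S.yd e : ℝ)) / S.m) := by
  have hn : (S.n : ℝ) ≠ 0 := by exact_mod_cast S.n_pos.ne'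
  have hm : (S.m : ℝ) ≠ 0 := by exact_mod_cast S.m_pos.ne'
  simp only [code, List.map_cons, digitValue, List.length_cons, List.length_map, Prod.mk.injEq]
  push_cast
  constructor <;> field_simp <;> ring

theorem mem_X_iff {v : S.V} {z : ℝ × ℝ} : z ∈ S.X v ↔ ∃ e, S.src e = v ∧ ∃ z' ∈ S.X (S.tgt e),
    z = ((z'.1 + (S.xd e : ℝ)) / S.n, (z'.2 + (S.yd e : ℝ)) / S.m) := by
  rw [S.X_invariant v]
  simp only [Set.mem_iUnion, Set.mem_image, Set.mem_ofPred_eq, exists_prop, eq_comm (a := z)]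

theorem exists_code_eq {v : S.V} {z : ℝ × ℝ} (hz : z ∈ S.X v) (k : ℕ) :
    ∃ w v', S.IsPath v w v' ∧ w.length = k ∧ ∃ z' ∈ S.X v', z = S.code w z' := by
  induction k generalizing v z with
  | zero => exact ⟨[], v, rfl, rfl, z, hz, by simp [code, digitValue]⟩
  | succ k ih =>
    obtain ⟨e, he, z₁, hz₁, rfl⟩ := mem_X_iff.1 hz
    obtain ⟨w, v', hw, hl, z', hz', rfl⟩ := ih hz₁
    exact ⟨e :: w, v', ⟨he, hw⟩, by simp [hl], z', hz', (code_cons e w z').symm⟩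

theorem code_mem {v v' : S.V} {w : List S.E} (hw : S.IsPath v w v') {z : ℝ × ℝ}
    (hz : z ∈ S.X v') : S.code w z ∈ S.X v := by
  induction w generalizing v with
  | nil =>
    obtain rfl : v = v' := hw
    simpa [code, digitValue] using hz
  | cons e w ih =>
    rw [code_cons]
    exact mem_X_iff.2 ⟨e, hw.1, _, ih hw.2, rfl⟩

theorem Xunion_subset : S.Xunion ⊆ Set.Icc (0 : ℝ) 1 ×ˢ Set.Icc (0 : ℝ) 1 :=
  Set.iUnion_subset S.X_subset

theorem totallyBounded_Xunion : TotallyBounded S.Xunion :=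
  (isCompact_Icc.prod isCompact_Icc).totallyBounded.subset Xunion_subset

theorem totallyBounded_snd_Xunion : TotallyBounded (Prod.snd '' S.Xunion) := by
  refine (isCompact_Icc (a := (0 : ℝ)) (b := 1)).totallyBounded.subset ?_
  rintro _ ⟨z, hz, rfl⟩
  exact (Xunion_subset hz).2

theorem code_snd_mem {v : S.V} {z : ℝ × ℝ} (hz : z ∈ S.X v) (w : List S.E) :
    (digitValue (w.map S.yd) : ℝ) / (S.m : ℝ) ^ w.length ≤ (S.code w z).2 ∧
      (S.code w z).2 ≤ ((digitValue (w.map S.yd) : ℝ) + 1) / (S.m : ℝ) ^ w.length := by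
  have hm : (0 : ℝ) < S.m := by exact_mod_cast S.m_pos
  obtain ⟨-, h1, h2⟩ := S.X_subset v hz
  simp only [code]
  constructor <;> refine div_le_div_of_nonneg_right (by linarith) (by positivity)

theorem code_fst_mem {v : S.V} {z : ℝ × ℝ} (hz : z ∈ S.X v) (w : List S.E) :
    (digitValue (w.map S.xd) : ℝ) / (S.n : ℝ) ^ w.length ≤ (S.code w z).1 ∧
      (S.code w z).1 ≤ ((digitValue (w.map S.xd) : ℝ) + 1) / (S.n : ℝ) ^ w.length := by
  have hn : (0 : ℝ) < S.n := by exact_mod_cast S.n_pos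
  obtain ⟨⟨h1, h2⟩, -⟩ := S.X_subset v hz
  simp only [code]
  constructor <;> refine div_le_div_of_nonneg_right (by linarith) (by positivity)

end GDBMCarpet

namespace GDBMCarpet

section Counting

variable (S : GDBMCarpet)

/-- The `y`-digit strings of length `k` realized by paths starting at `v`. -/
def yStrings (v : S.V) (k : ℕ) : Finset (List (Fin S.m)) :=
  (List.finite_length_eq (Fin S.m) k).toFinset.filter
    fun ys => ∃ w v', S.IsPath v w v' ∧ w.map S.yd = ys

/-- The `y`-digit strings of length `k` realized by paths of the graph. -/
def allYStrings (k : ℕ) : Finset (List (Fin S.m)) :=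
  Finset.univ.biUnion fun v => S.yStrings v k

/-- The paths from `v` to `v'` with `y`-digit string `ys`. -/
def pathsOver (v v' : S.V) (ys : List (Fin S.m)) : Finset (List S.E) :=
  (List.finite_length_eq S.E ys.length).toFinset.filter
    fun w => S.IsPath v w v' ∧ w.map S.yd = ys

variable {S}

theorem mem_yStrings {v : S.V} {k : ℕ} {ys : List (Fin S.m)} :
    ys ∈ S.yStrings v k ↔ ys.length = k ∧ ∃ w v', S.IsPath v w v' ∧ w.map S.yd = ys := by
  simp [yStrings]

theorem mem_allYStrings {k : ℕ} {ys : List (Fin S.m)} :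
    ys ∈ S.allYStrings k ↔ ys.length = k ∧ ∃ v w v', S.IsPath v w v' ∧ w.map S.yd = ys := by
  simp [allYStrings, mem_yStrings]

theorem mem_pathsOver {v v' : S.V} {ys : List (Fin S.m)} {w : List S.E} :
    w ∈ S.pathsOver v v' ys ↔ S.IsPath v w v' ∧ w.map S.yd = ys := by
  simp only [pathsOver, Finset.mem_filter, Set.Finite.mem_toFinset, Set.mem_ofPred_eq,
    and_iff_right_iff_imp]
  rintro ⟨-, rfl⟩
  simp

theorem pathsOver_cons (v v' : S.V) (y : Fin S.m) (ys : List (Fin S.m)) :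
    S.pathsOver v v' (y :: ys) =
      (Finset.univ.filter fun e => S.src e = v ∧ S.yd e = y).biUnion
        fun e => (S.pathsOver (S.tgt e) v' ys).map ⟨List.cons e, List.cons_injective⟩ := by
  ext w
  simp only [mem_pathsOver, Finset.mem_biUnion, Finset.mem_filter, Finset.mem_univ, true_and,
    Finset.mem_map, Function.Embedding.coeFn_mk]
  constructor
  · rintro ⟨hw, hy⟩
    obtain _ | ⟨e, w⟩ := w
    · simp at hy
    · simp only [List.map_cons, List.cons.injEq] at hy
      exact ⟨e, ⟨hw.1, hy.1⟩, w, ⟨hw.2, hy.2⟩, rfl⟩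
  · rintro ⟨e, ⟨h1, h2⟩, w, ⟨h3, h4⟩, rfl⟩
    exact ⟨⟨h1, h3⟩, by simp [h2, h4]⟩

theorem card_pathsOver (v v' : S.V) (ys : List (Fin S.m)) :
    ((S.pathsOver v v' ys).card : ℝ) = (ys.map S.Amat).prod v v' := by
  induction ys generalizing v with
  | nil =>
    rw [List.map_nil, List.prod_nil, Matrix.one_apply]
    have : S.pathsOver v v' [] = if v = v' then {[]} else ∅ := by
      ext w
      rw [mem_pathsOver, List.map_eq_nil_iff]
      split_ifs with h
      · simp only [Finset.mem_singleton, and_iff_right_iff_imp]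
        rintro rfl
        exact h
      · simp only [Finset.notMem_empty, iff_false]
        rintro ⟨hw, rfl⟩
        exact h hw
    rw [this]
    split_ifs <;> simp
  | cons y ys ih =>
    rw [List.map_cons, List.prod_cons, Matrix.mul_apply, pathsOver_cons, Finset.card_biUnion]
    · simp only [Finset.card_map, Nat.cast_sum, ih, Amat]
      rw [← Finset.sum_fiberwise (Finset.univ.filter fun e => S.src e = v ∧ S.yd e = y) S.tgt]
      refine Finset.sum_congr rfl fun u _ => ?_
      rw [Finset.filter_filter, Finset.sum_congr rfl (g := fun _ => (ys.map S.Amat).prod u v'),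
        Finset.sum_const, nsmul_eq_mul]
      · congr 3
        ext e
        simp only [Finset.mem_filter, Finset.mem_univ, true_and]
        tauto
      · intro e he
        rw [(Finset.mem_filter.1 he).2.2]
    · intro e _ e' _ hne
      rw [Function.onFun, Finset.disjoint_left]
      intro w hw hw'
      simp only [Finset.mem_map, Function.Embedding.coeFn_mk] at hw hw'
      obtain ⟨a, -, rfl⟩ := hw
      obtain ⟨b, -, hb⟩ := hw'
      exact hne (List.cons.inj hb).1.symm

theorem card_yStrings_add_le (v : S.V) (i j : ℕ) :
    (S.yStrings v (i + j)).card ≤ (S.yStrings v i).card * (S.allYStrings j).card := by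
  rw [← Finset.card_product]
  refine Finset.card_le_card_of_injOn (fun ys => (ys.take i, ys.drop i)) ?_ ?_
  · intro ys hys
    obtain ⟨hl, w, v', hw, rfl⟩ := mem_yStrings.1 hys
    rw [← List.take_append_drop i w] at hw
    obtain ⟨u, h1, h2⟩ := isPath_append.1 hw
    rw [List.length_map] at hl
    simp only [Finset.coe_product, Set.mem_prod, Finset.mem_coe, mem_yStrings, mem_allYStrings]
    exact ⟨⟨by simp [hl], _, _, h1, by rw [List.map_take]⟩,
      ⟨by simp [hl], _, _, _, h2, by rw [List.map_drop]⟩⟩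
  · intro ys _ ys' _ h
    simp only [Prod.mk.injEq] at h
    rw [← List.take_append_drop i ys, ← List.take_append_drop i ys', h.1, h.2]

theorem card_allYStrings_add_le (i j : ℕ) :
    (S.allYStrings (i + j)).card ≤ (S.allYStrings i).card * (S.allYStrings j).card := by
  rw [← Finset.card_product]
  refine Finset.card_le_card_of_injOn (fun ys => (ys.take i, ys.drop i)) ?_ ?_
  · intro ys hys
    obtain ⟨hl, v, w, v', hw, rfl⟩ := mem_allYStrings.1 hys
    rw [← List.take_append_drop i w] at hw
    obtain ⟨u, h1, h2⟩ := isPath_append.1 hw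
    rw [List.length_map] at hl
    simp only [Finset.coe_product, Set.mem_prod, Finset.mem_coe, mem_allYStrings]
    exact ⟨⟨by simp [hl], _, _, _, h1, by rw [List.map_take]⟩,
      ⟨by simp [hl], _, _, _, h2, by rw [List.map_drop]⟩⟩
  · intro ys _ ys' _ h
    simp only [Prod.mk.injEq] at h
    rw [← List.take_append_drop i ys, ← List.take_append_drop i ys', h.1, h.2]

theorem card_allYStrings_pos [Nonempty S.V] (k : ℕ) : 0 < (S.allYStrings k).card := by
  obtain ⟨w, v', hw, hl⟩ := exists_isPath_from (Classical.arbitrary S.V) k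
  exact Finset.card_pos.2 ⟨w.map S.yd, mem_allYStrings.2 ⟨by simp [hl], _, _, _, hw, rfl⟩⟩

theorem exists_card_yStrings_le (hirr : S.GraphIrreducible) (v v' : S.V) :
    ∃ C : ℕ, ∀ i, (S.yStrings v i).card ≤ C * (S.yStrings v' i).card := by
  obtain ⟨k, -, hk⟩ := hirr v' v
  obtain ⟨q, hq, hql⟩ := exists_isPath_of_adjMat_pow_pos hk
  refine ⟨(S.allYStrings k).card, fun i => ?_⟩
  rw [mul_comm]
  refine le_trans ?_ (card_yStrings_add_le v' i k)
  refine Finset.card_le_card_of_injOn (fun ys => q.map S.yd ++ ys) ?_ ?_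
  · intro ys hys
    obtain ⟨hl, w, u, hw, rfl⟩ := mem_yStrings.1 hys
    refine mem_yStrings.2 ⟨?_, q ++ w, u, isPath_append.2 ⟨v, hq, hw⟩, by simp⟩
    rw [List.length_append, hl, List.length_map, hql, add_comm]
  · intro ys _ ys' _ h
    exact List.append_cancel_left h

theorem exists_card_allYStrings_le (hirr : S.GraphIrreducible) :
    ∃ C : ℕ, ∀ v i, (S.allYStrings i).card ≤ C * (S.yStrings v i).card := by
  choose C hC using exists_card_yStrings_le hirr
  refine ⟨∑ v, ∑ v', C v v', fun v i => ?_⟩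
  calc (S.allYStrings i).card ≤ ∑ v', (S.yStrings v' i).card := Finset.card_biUnion_le
    _ ≤ ∑ v', (∑ u, C v' u) * (S.yStrings v i).card := by
      refine Finset.sum_le_sum fun v' _ => (hC v' v i).trans (Nat.mul_le_mul_right _ ?_)
      exact Finset.single_le_sum (f := C v') (fun _ _ => Nat.zero_le _) (Finset.mem_univ v)
    _ = _ := by rw [Finset.sum_mul]

variable (S) in
theorem exists_tendsto_log_card_allYStrings [Nonempty S.V] :
    ∃ h : ℝ, 0 ≤ h ∧ Tendsto (fun k : ℕ => 1 / (k : ℝ) * Real.log (S.allYStrings k).card)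
      atTop (𝓝 h) ∧ ∀ k : ℕ, h * k ≤ Real.log (S.allYStrings k).card := by
  have hpos : ∀ k, (0 : ℝ) < (S.allYStrings k).card := fun k => by
    exact_mod_cast card_allYStrings_pos k
  have hnn : ∀ k, 0 ≤ Real.log (S.allYStrings k).card := fun k =>
    Real.log_nonneg (by exact_mod_cast card_allYStrings_pos k)
  have hsub : Subadditive fun k => Real.log (S.allYStrings k).card := fun i j => by
    rw [← Real.log_mul (hpos i).ne' (hpos j).ne']
    exact Real.log_le_log (hpos _) (by exact_mod_cast card_allYStrings_add_le i j)
  have hbdd : BddBelow (Set.range fun k : ℕ => Real.log (S.allYStrings k).card / k) :=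
    ⟨0, by rintro _ ⟨k, rfl⟩; exact div_nonneg (hnn k) (Nat.cast_nonneg k)⟩
  have hlim := hsub.tendsto_lim hbdd
  refine ⟨hsub.lim, ge_of_tendsto' hlim fun k => div_nonneg (hnn k) (Nat.cast_nonneg k),
    by simpa [div_eq_inv_mul] using hlim, fun k => ?_⟩
  rcases k.eq_zero_or_pos with rfl | hk
  · simpa using hnn 0
  · have := hsub.lim_le_div hbdd hk.ne'
    rwa [le_div_iff₀ (by exact_mod_cast hk)] at this

end Counting

section BoxDim

variable {S : GDBMCarpet}

theorem coverNum_snd_le {r : ℝ} {k : ℕ} (hr : 1 / (S.m : ℝ) ^ k ≤ r) :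
    coverNum r (Prod.snd '' S.Xunion) ≤ (S.allYStrings k).card := by
  refine (coverNum_le_card ((S.allYStrings k).image
    fun ys => (digitValue ys : ℝ) / (S.m : ℝ) ^ k) ?_).trans Finset.card_image_le
  rintro _ ⟨z, hz, rfl⟩
  obtain ⟨v, hv⟩ := Set.mem_iUnion.1 hz
  obtain ⟨w, v', hw, rfl, z', hz', rfl⟩ := exists_code_eq hv k
  have := code_snd_mem hz' w
  refine Set.mem_iUnion₂.2 ⟨_, Finset.mem_image_of_mem _
    (mem_allYStrings.2 ⟨List.length_map _, v, w, v', hw, rfl⟩), ?_⟩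
  rw [mem_closedBall, Real.dist_eq, abs_le]
  rw [add_div] at this
  constructor <;> linarith [this.1, this.2]

theorem le_and_le_of_mem_closedBall {B r x t : ℝ} {a : ℕ} (hB : 0 < B) (hr : r ≤ 1 / B)
    (h1 : a / B ≤ x) (h2 : x ≤ (a + 1) / B) (h : |x - t| ≤ r) :
    t * B - 2 ≤ a ∧ (a : ℝ) ≤ t * B + 1 := by
  rw [le_div_iff₀ hB] at h2 hr
  rw [div_le_iff₀ hB] at h1
  obtain ⟨h3, h4⟩ := abs_le.1 h
  constructor <;> nlinarith

theorem card_allYStrings_le {r : ℝ} (hr0 : 0 < r) {k : ℕ} (hr : r ≤ 1 / (S.m : ℝ) ^ k) :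
    (S.allYStrings k).card ≤ 4 * coverNum r (Prod.snd '' S.Xunion) := by
  have hm : (0 : ℝ) < S.m := by exact_mod_cast S.m_pos
  have key : ∀ ys : List (Fin S.m), ys ∈ S.allYStrings k → ∃ x ∈ Prod.snd '' S.Xunion,
      (digitValue ys : ℝ) / (S.m : ℝ) ^ k ≤ x ∧ x ≤ (digitValue ys + 1) / (S.m : ℝ) ^ k := by
    intro ys hys
    obtain ⟨hl, v, w, v', hw, rfl⟩ := mem_allYStrings.1 hys
    obtain ⟨z, hz⟩ := S.X_nonempty v'
    rw [List.length_map] at hl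
    subst hl
    exact ⟨_, ⟨_, Set.mem_iUnion.2 ⟨v, code_mem hw hz⟩, rfl⟩, code_snd_mem hz w⟩
  choose! f hf hf1 hf2 using key
  refine card_le_mul_coverNum totallyBounded_snd_Xunion hr0 _ f hf 4 fun t => ?_
  rw [← Finset.card_image_of_injOn (f := digitValue)]
  · refine card_le_four (t := t * (S.m : ℝ) ^ k) fun a ha => ?_
    obtain ⟨ys, hys, rfl⟩ := Finset.mem_image.1 ha
    obtain ⟨hys, hy⟩ := Finset.mem_filter.1 hys
    exact le_and_le_of_mem_closedBall (by positivity) hr (hf1 _ hys) (hf2 _ hys) hy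
  · intro ys hys ys' hys' h
    simp only [Finset.coe_filter, Set.mem_ofPred_eq, mem_allYStrings] at hys hys'
    exact digitValue_injective (hys.1.1.trans hys'.1.1.symm) h

theorem boxDim_snd_Xunion [Nonempty S.V] {h : ℝ} (hh : 0 ≤ h)
    (hlim : Tendsto (fun k : ℕ => 1 / (k : ℝ) * Real.log (S.allYStrings k).card) atTop (𝓝 h))
    (hle : ∀ k : ℕ, h * k ≤ Real.log (S.allYStrings k).card) :
    boxDim (Prod.snd '' S.Xunion) = h / Real.log S.m := by
  have hm0 : (0 : ℝ) < S.m := by exact_mod_cast S.m_pos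
  have hlog : 0 < Real.log S.m := Real.log_pos S.one_lt_m
  have hpos : ∀ k, (0 : ℝ) < (S.allYStrings k).card := fun k => by
    exact_mod_cast card_allYStrings_pos k
  set d := h / Real.log S.m with hd
  have hd0 : 0 ≤ d := by positivity
  have hscale : ∀ r : ℝ, 0 < r → r < 1 → ∃ k : ℕ,
      Real.log (1 / r) ≤ (k + 1) * Real.log S.m ∧ k * Real.log S.m ≤ Real.log (1 / r) ∧
      (S.allYStrings k).card ≤ 4 * coverNum r (Prod.snd '' S.Xunion) ∧
      coverNum r (Prod.snd '' S.Xunion) ≤ (S.allYStrings (k + 1)).card := by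
    intro r hr hr1
    obtain ⟨k, hk, hk'⟩ := exists_nat_pow_near (one_le_one_div hr hr1.le) S.one_lt_m
    refine ⟨k, ?_, ?_, card_allYStrings_le hr ?_, coverNum_snd_le ?_⟩
    · have := Real.log_le_log (by positivity) hk'.le
      rwa [Real.log_pow, Nat.cast_add, Nat.cast_one] at this
    · have := Real.log_le_log (by positivity) hk
      rwa [Real.log_pow] at this
    · rwa [le_one_div hr (by positivity)]
    · rw [one_div_le (by positivity) hr]; exact hk'.le
  have hlogr : Tendsto (fun r : ℝ => Real.log (1 / r)) (𝓝[>] 0) atTop := by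
    simp only [one_div, Real.log_inv]
    exact tendsto_neg_atBot_atTop.comp Real.tendsto_log_nhdsGT_zero
  have hsmall : ∀ᶠ r : ℝ in 𝓝[>] 0, 0 < r ∧ r < 1 := Ioo_mem_nhdsGT one_pos
  refine Tendsto.limsup_eq (tendsto_order.2 ⟨fun a ha => ?_, fun a ha => ?_⟩)
  · filter_upwards [hsmall, hlogr.eventually_gt_atTop 0,
      hlogr.eventually_gt_atTop ((h + Real.log 4) / (d - a))] with r hr hr' hr''
    obtain ⟨k, h1, -, h3, -⟩ := hscale r hr.1 hr.2
    rw [lt_div_iff₀ hr']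
    rw [div_lt_iff₀ (by linarith)] at hr''
    have hc : (0 : ℝ) < coverNum r (Prod.snd '' S.Xunion) := by
      have := card_allYStrings_pos (S := S) k
      exact_mod_cast (by omega : 0 < coverNum r (Prod.snd '' S.Xunion))
    have h4 : Real.log (S.allYStrings k).card ≤
        Real.log 4 + Real.log (coverNum r (Prod.snd '' S.Xunion)) := by
      rw [← Real.log_mul (by norm_num) hc.ne']
      exact Real.log_le_log (hpos k) (by exact_mod_cast h3)
    have h5 : d * Real.log (1 / r) ≤ d * ((k + 1) * Real.log S.m) :=
      mul_le_mul_of_nonneg_left h1 hd0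
    have h6 : d * ((k + 1) * Real.log S.m) = h * k + h := by rw [hd]; field_simp
    linarith [hle k]
  · obtain ⟨t, ht, hta⟩ := exists_between ha
    have ht0 : 0 < t := hd0.trans_lt ht
    obtain ⟨C, hC, hCk⟩ := exists_le_rpow_of_tendsto S.one_lt_m hlim ht
    filter_upwards [hsmall, hlogr.eventually_gt_atTop 0,
      hlogr.eventually_gt_atTop ((Real.log C + t * Real.log S.m) / (a - t))] with r hr hr' hr''
    obtain ⟨k, -, h2, h3, h4⟩ := hscale r hr.1 hr.2
    rw [div_lt_iff₀ hr']
    rw [div_lt_iff₀ (by linarith)] at hr''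
    have hc : (0 : ℝ) < coverNum r (Prod.snd '' S.Xunion) := by
      have := card_allYStrings_pos (S := S) k
      exact_mod_cast (by omega : 0 < coverNum r (Prod.snd '' S.Xunion))
    have h5 : Real.log (coverNum r (Prod.snd '' S.Xunion)) ≤
        Real.log C + t * ((k + 1) * Real.log S.m) := by
      have := Real.log_le_log hc ((Nat.cast_le.2 h4).trans (hCk (k + 1)))
      rwa [Real.log_mul hC.ne' (by positivity), Real.log_rpow (by positivity), Real.log_pow,
        Nat.cast_add, Nat.cast_one] at this
    nlinarith

end BoxDim

end GDBMCarpet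

namespace GDBMCarpet

variable {S : GDBMCarpet}

theorem code_append (w w' : List S.E) (z : ℝ × ℝ) :
    S.code (w ++ w') z = S.code w (S.code w' z) := by
  induction w with
  | nil => simp [code, digitValue]
  | cons e w ih => rw [List.cons_append, code_cons, code_cons, ih]

theorem eq_of_digits_eq (hROSC : S.ROSC) {e e' : S.E} (hs : S.src e = S.src e')
    (hx : S.xd e = S.xd e') (hy : S.yd e = S.yd e') : e = e' := by
  by_contra hne
  have h := (hROSC (S.src e)).2 e e' rfl hs.symm hne
  have hpsi : S.psi e = S.psi e' := by
    funext p
    simp only [psi, hx, hy]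
  rw [hpsi, disjoint_self, Set.bot_eq_empty, Set.image_eq_empty] at h
  have : ((1 / 2, 1 / 2) : ℝ × ℝ) ∈ openSquare := by
    constructor <;> constructor <;> norm_num
  rw [h] at this
  exact this

theorem injOn_map_xd_pathsOver (hROSC : S.ROSC) (v v' : S.V) (ys : List (Fin S.m)) :
    Set.InjOn (List.map S.xd) (S.pathsOver v v' ys : Set (List S.E)) := by
  suffices H : ∀ (w w' : List S.E) (v : S.V), S.IsPath v w v' → S.IsPath v w' v' →
      w.map S.yd = w'.map S.yd → w.map S.xd = w'.map S.xd → w = w' by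
    intro w hw w' hw' h
    obtain ⟨h1, h2⟩ := mem_pathsOver.1 hw
    obtain ⟨h3, h4⟩ := mem_pathsOver.1 hw'
    exact H w w' v h1 h3 (h2.trans h4.symm) h
  intro w
  induction w with
  | nil =>
    intro w' v _ _ h _
    exact (List.map_eq_nil_iff.1 h.symm).symm
  | cons e w ih =>
    intro w' v hw hw' hy hx
    obtain _ | ⟨e', w'⟩ := w'
    · simp at hy
    simp only [List.map_cons, List.cons.injEq] at hx hy
    obtain rfl : e = e' := eq_of_digits_eq hROSC (hw.1.trans hw'.1.symm) hx.1 hy.1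
    rw [ih w' _ hw.2 hw'.2 hy.2 hx.2]

theorem card_filter_digitValue_le (b k : ℕ) (t : ℝ) :
    ((List.finite_length_eq (Fin b) k).toFinset.filter fun l =>
      t - 2 ≤ digitValue l ∧ (digitValue l : ℝ) ≤ t + 1).card ≤ 4 := by
  rw [← Finset.card_image_of_injOn (f := digitValue)]
  · refine card_le_four (t := t) fun a ha => ?_
    obtain ⟨l, hl, rfl⟩ := Finset.mem_image.1 ha
    exact (Finset.mem_filter.1 hl).2
  · intro l hl l' hl' h
    simp only [Finset.coe_filter, Set.mem_ofPred_eq, Set.Finite.mem_toFinset] at hl hl'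
    exact digitValue_injective (hl.1.trans hl'.1.symm) h

theorem coverNum_inter_ball_le {x : ℝ × ℝ} {r R : ℝ} {k l i j B : ℕ} (hle : l + j ≤ k + i)
    (hRm : R ≤ 1 / (S.m : ℝ) ^ k) (hRn : R ≤ 1 / (S.n : ℝ) ^ l)
    (hrm : 1 / (S.m : ℝ) ^ (k + i) ≤ r) (hrn : 1 / (S.n : ℝ) ^ (l + j) ≤ r)
    (hB : ∀ ys v v', ys.length = j → (S.pathsOver v v' ys).card ≤ B) :
    coverNum r (S.Xunion ∩ ball x R) ≤
      4 * (4 * ((S.allYStrings i).card * (Fintype.card (S.V × S.V) * B))) := by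
  have hm : (0 : ℝ) < S.m := by exact_mod_cast S.m_pos
  have hn : (0 : ℝ) < S.n := by exact_mod_cast S.n_pos
  let F : (b : ℕ) → ℕ → ℝ → Finset (List (Fin b)) := fun b k t =>
    (List.finite_length_eq (Fin b) k).toFinset.filter fun l =>
      t - 2 ≤ digitValue l ∧ (digitValue l : ℝ) ≤ t + 1
  let T : Finset (ℝ × ℝ) :=
    (F S.m k (x.2 * (S.m : ℝ) ^ k)).biUnion fun ys =>
      (F S.n l (x.1 * (S.n : ℝ) ^ l)).biUnion fun xs =>
        (S.allYStrings i).biUnion fun t =>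
          (Finset.univ : Finset (S.V × S.V)).biUnion fun p =>
            (S.pathsOver p.1 p.2 (((ys ++ t).drop l).take j)).image fun w =>
              ((digitValue (xs ++ w.map S.xd) : ℝ) / (S.n : ℝ) ^ (l + j),
                (digitValue (ys ++ t) : ℝ) / (S.m : ℝ) ^ (k + i))
  refine (coverNum_le_card T ?_).trans ?_
  · rintro z ⟨hz, hzx⟩
    obtain ⟨v, hv⟩ := Set.mem_iUnion.1 hz
    obtain ⟨w, v', hw, hwl, z', hz', rfl⟩ := exists_code_eq hv (k + i)
    have hyl : (w.map S.yd).length = k + i := by simp [hwl]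
    rw [mem_ball, Prod.dist_eq, max_lt_iff, Real.dist_eq, Real.dist_eq] at hzx
    obtain ⟨wk, wi, hwki, hkl⟩ : ∃ wk wi, w = wk ++ wi ∧ wk.length = k :=
      ⟨w.take k, w.drop k, (List.take_append_drop k w).symm, by simp [hwl]⟩
    obtain ⟨wl, w₁, hwl₁, hll⟩ : ∃ wl w₁, w = wl ++ w₁ ∧ wl.length = l :=
      ⟨w.take l, w.drop l, (List.take_append_drop l w).symm, by simp [hwl]; omega⟩
    have hw₁l : w₁.length + l = k + i := by
      rw [← hwl, hwl₁, List.length_append, hll, add_comm]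
    obtain ⟨w₂, w₃, hw₂₃, hjl⟩ : ∃ w₂ w₃, w₁ = w₂ ++ w₃ ∧ w₂.length = j :=
      ⟨w₁.take j, w₁.drop j, (List.take_append_drop j w₁).symm, by simp; omega⟩
    have hil : wi.length = i := by
      rw [hwki, List.length_append, hkl] at hwl
      omega
    obtain ⟨u, hu₁, hu₂⟩ := isPath_append.1 (hwki ▸ hw)
    obtain ⟨a, ha₁, ha₂⟩ := isPath_append.1 (hwl₁ ▸ hw)
    obtain ⟨b, hb₁, hb₂⟩ := isPath_append.1 (hw₂₃ ▸ ha₂)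
    have hy1 := code_snd_mem (code_mem hu₂ hz') wk
    rw [← code_append, ← hwki, hkl] at hy1
    have hx1 := code_fst_mem (code_mem ha₂ hz') wl
    rw [← code_append, ← hwl₁, hll] at hx1
    have hy2 := code_snd_mem hz' w
    have hx2 := code_fst_mem (code_mem hb₂ hz') (wl ++ w₂)
    rw [← code_append, List.append_assoc, ← hw₂₃, ← hwl₁, List.length_append, hll, hjl] at hx2
    have hwin1 : wk.map S.yd ∈ F S.m k (x.2 * (S.m : ℝ) ^ k) := by
      simp only [F, Finset.mem_filter, Set.Finite.mem_toFinset, Set.mem_ofPred_eq,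
        List.length_map]
      exact ⟨hkl, le_and_le_of_mem_closedBall (by positivity) hRm hy1.1 hy1.2 hzx.2.le⟩
    have hwin2 : wl.map S.xd ∈ F S.n l (x.1 * (S.n : ℝ) ^ l) := by
      simp only [F, Finset.mem_filter, Set.Finite.mem_toFinset, Set.mem_ofPred_eq,
        List.length_map]
      exact ⟨hll, le_and_le_of_mem_closedBall (by positivity) hRn hx1.1 hx1.2 hzx.1.le⟩
    have hmid : ((wk.map S.yd ++ wi.map S.yd).drop l).take j = w₂.map S.yd := by
      rw [← List.map_append, ← hwki, hwl₁, hw₂₃, List.map_append, List.map_append,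
        List.drop_left' (by simp [hll]), List.take_left' (by simp [hjl])]
    refine Set.mem_iUnion₂.2
      ⟨((digitValue (wl.map S.xd ++ w₂.map S.xd) : ℝ) / (S.n : ℝ) ^ (l + j),
        (digitValue (wk.map S.yd ++ wi.map S.yd) : ℝ) / (S.m : ℝ) ^ (k + i)), ?_, ?_⟩
    · refine Finset.mem_biUnion.2 ⟨_, hwin1, Finset.mem_biUnion.2 ⟨_, hwin2,
        Finset.mem_biUnion.2 ⟨wi.map S.yd, mem_allYStrings.2 ⟨by simp [hil], _, _, _, hu₂, rfl⟩,
        Finset.mem_biUnion.2 ⟨(a, b), Finset.mem_univ _,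
        Finset.mem_image.2 ⟨w₂, ?_, rfl⟩⟩⟩⟩⟩
      rw [hmid]
      exact mem_pathsOver.2 ⟨hb₁, rfl⟩
    · rw [← List.map_append, ← List.map_append, ← hwki, mem_closedBall, Prod.dist_eq,
        max_le_iff, Real.dist_eq, Real.dist_eq, abs_le, abs_le]
      rw [add_div] at hx2 hy2
      rw [hwl] at hy2
      refine ⟨⟨?_, ?_⟩, ?_, ?_⟩ <;> dsimp only <;>
        linarith [hx2.1, hx2.2, hy2.1, hy2.2, one_div_nonneg.2 (pow_nonneg hn.le (l + j)),
          one_div_nonneg.2 (pow_nonneg hm.le (k + i))]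
  · refine (Finset.card_biUnion_le_card_mul _ _ _ fun ys hys => ?_).trans
      (Nat.mul_le_mul_right _ (card_filter_digitValue_le _ _ _))
    refine (Finset.card_biUnion_le_card_mul _ _ _ fun xs _ => ?_).trans
      (Nat.mul_le_mul_right _ (card_filter_digitValue_le _ _ _))
    refine Finset.card_biUnion_le_card_mul _ _ _ fun t ht => ?_
    refine (Finset.card_biUnion_le_card_mul _ _ _ fun p _ => ?_).trans_eq (by rw [Finset.card_univ])
    refine Finset.card_image_le.trans (hB _ _ _ ?_)
    simp only [F, Finset.mem_filter, Set.Finite.mem_toFinset, Set.mem_ofPred_eq] at hys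
    rw [List.length_take, List.length_drop, List.length_append, hys.1, (mem_allYStrings.1 ht).1]
    omega

theorem exists_card_mul_card_le_coverNum (hROSC : S.ROSC) (hirr : S.GraphIrreducible) {r : ℝ}
    {ys : List (Fin S.m)} {v v' : S.V} (hne : (S.pathsOver v v' ys).Nonempty) {k l i : ℕ}
    (hk : l + ys.length = k) (hln : (S.m : ℝ) ^ k ≤ (S.n : ℝ) ^ l)
    (hr0 : 0 < r) (hrn : r ≤ 1 / (S.n : ℝ) ^ k) (hrm : r ≤ 1 / (S.m : ℝ) ^ (k + i)) :
    ∃ x ∈ S.Xunion, (S.pathsOver v v' ys).card * (S.yStrings v' i).card ≤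
      16 * coverNum r (S.Xunion ∩ ball x (2 / (S.m : ℝ) ^ k)) := by
  have hm : (0 : ℝ) < S.m := by exact_mod_cast S.m_pos
  have hn : (0 : ℝ) < S.n := by exact_mod_cast S.n_pos
  obtain ⟨q, u, hq, hql⟩ := exists_isPath_to hirr v l
  have hlen : ∀ w ∈ S.pathsOver v v' ys, (q ++ w).length = k := by
    intro w hw
    rw [List.length_append, hql, ← hk, ← (mem_pathsOver.1 hw).2, List.length_map]
  have hpath : ∀ w ∈ S.pathsOver v v' ys, S.IsPath u (q ++ w) v' := fun w hw =>
    isPath_append.2 ⟨v, hq, (mem_pathsOver.1 hw).1⟩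
  have hfst : ∀ w ∈ S.pathsOver v v' ys, ∀ z ∈ S.X v',
      (digitValue (q.map S.xd) : ℝ) / (S.n : ℝ) ^ l ≤ (S.code (q ++ w) z).1 ∧
      (S.code (q ++ w) z).1 ≤ ((digitValue (q.map S.xd) : ℝ) + 1) / (S.n : ℝ) ^ l := by
    intro w hw z hz
    have := code_fst_mem (code_mem (mem_pathsOver.1 hw).1 hz) q
    rwa [← code_append, hql] at this
  have hsnd : ∀ w ∈ S.pathsOver v v' ys, ∀ z ∈ S.X v',
      (digitValue (q.map S.yd ++ ys) : ℝ) / (S.m : ℝ) ^ k ≤ (S.code (q ++ w) z).2 ∧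
      (S.code (q ++ w) z).2 ≤ ((digitValue (q.map S.yd ++ ys) : ℝ) + 1) / (S.m : ℝ) ^ k := by
    intro w hw z hz
    have := code_snd_mem hz (q ++ w)
    rwa [hlen w hw, List.map_append, (mem_pathsOver.1 hw).2] at this
  obtain ⟨w₀, hw₀⟩ := hne
  obtain ⟨z₀, hz₀⟩ := S.X_nonempty v'
  have key : ∀ t ∈ S.yStrings v' i, ∃ z ∈ S.X v', ∀ w ∈ S.pathsOver v v' ys,
      (digitValue ((q ++ w).map S.yd ++ t) : ℝ) / (S.m : ℝ) ^ (k + i) ≤ (S.code (q ++ w) z).2 ∧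
      (S.code (q ++ w) z).2 ≤
        (digitValue ((q ++ w).map S.yd ++ t) + 1) / (S.m : ℝ) ^ (k + i) := by
    intro t ht
    obtain ⟨hl, p, b, hp, rfl⟩ := mem_yStrings.1 ht
    obtain ⟨z, hz⟩ := S.X_nonempty b
    rw [List.length_map] at hl
    refine ⟨_, code_mem hp hz, fun w hw => ?_⟩
    have := code_snd_mem hz ((q ++ w) ++ p)
    rwa [code_append, List.map_append, List.length_append, hlen w hw, hl] at this
  choose! g hg hgw using key
  refine ⟨S.code (q ++ w₀) z₀, Set.mem_iUnion.2 ⟨u, code_mem (hpath _ hw₀) hz₀⟩, ?_⟩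
  rw [← Finset.card_product]
  refine card_le_mul_coverNum (totallyBounded_Xunion.subset Set.inter_subset_left) hr0 _
    (fun p => S.code (q ++ p.1) (g p.2)) ?_ 16 fun c => ?_
  · rintro ⟨w, t⟩ hp
    obtain ⟨hw, ht⟩ := Finset.mem_product.1 hp
    refine ⟨Set.mem_iUnion.2 ⟨u, code_mem (hpath _ hw) (hg _ ht)⟩, ?_⟩
    have h1 := hfst w hw _ (hg _ ht)
    have h2 := hfst _ hw₀ _ hz₀
    have h3 := hsnd w hw _ (hg _ ht)
    have h4 := hsnd _ hw₀ _ hz₀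
    have h5 : 1 / (S.n : ℝ) ^ l ≤ 1 / (S.m : ℝ) ^ k := by gcongr
    have h6 : 0 < 1 / (S.m : ℝ) ^ k := by positivity
    rw [show 2 / (S.m : ℝ) ^ k = 2 * (1 / (S.m : ℝ) ^ k) by ring, mem_ball, Prod.dist_eq,
      max_lt_iff, Real.dist_eq, Real.dist_eq, abs_lt, abs_lt]
    rw [add_div] at h1 h2 h3 h4
    refine ⟨⟨?_, ?_⟩, ?_, ?_⟩ <;> dsimp only <;>
      linarith [h1.1, h1.2, h2.1, h2.2, h3.1, h3.2, h4.1, h4.2]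
  · set I := (S.pathsOver v v' ys ×ˢ S.yStrings v' i).filter
      fun p => S.code (q ++ p.1) (g p.2) ∈ closedBall c r with hI
    have hIm : ∀ p ∈ I, p.1 ∈ S.pathsOver v v' ys ∧ p.2 ∈ S.yStrings v' i ∧
        |(S.code (q ++ p.1) (g p.2)).1 - c.1| ≤ r ∧ |(S.code (q ++ p.1) (g p.2)).2 - c.2| ≤ r := by
      intro p hp
      rw [hI, Finset.mem_filter, Finset.mem_product, mem_closedBall, Prod.dist_eq,
        max_le_iff, Real.dist_eq, Real.dist_eq] at hp
      exact ⟨hp.1.1, hp.1.2, hp.2⟩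
    let g₁ : List S.E × List (Fin S.m) → ℕ := fun p => digitValue ((q ++ p.1).map S.xd)
    let g₂ : List S.E × List (Fin S.m) → ℕ := fun p => digitValue ((q ++ p.1).map S.yd ++ p.2)
    have h1 : (I.image g₁).card ≤ 4 := by
      refine card_le_four (t := c.1 * (S.n : ℝ) ^ k) fun a ha => ?_
      obtain ⟨p, hp, rfl⟩ := Finset.mem_image.1 ha
      obtain ⟨hw, ht, hp1, -⟩ := hIm p hp
      have := code_fst_mem (hg _ ht) (q ++ p.1)
      rw [hlen _ hw] at this
      exact le_and_le_of_mem_closedBall (by positivity) hrn this.1 this.2 hp1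
    have h2 : (I.image g₂).card ≤ 4 := by
      refine card_le_four (t := c.2 * (S.m : ℝ) ^ (k + i)) fun a ha => ?_
      obtain ⟨p, hp, rfl⟩ := Finset.mem_image.1 ha
      obtain ⟨hw, ht, -, hp2⟩ := hIm p hp
      have := hgw _ ht _ hw
      exact le_and_le_of_mem_closedBall (by positivity) hrm this.1 this.2 hp2
    calc I.card ≤ (I.image g₁ ×ˢ I.image g₂).card := by
          refine Finset.card_le_card_of_injOn (fun p => (g₁ p, g₂ p)) ?_ ?_
          · intro p hp
            exact Finset.mem_coe.2 (Finset.mem_product.2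
              ⟨Finset.mem_image_of_mem _ hp, Finset.mem_image_of_mem _ hp⟩)
          · rintro ⟨w, t⟩ hp ⟨w', t'⟩ hp' h
            obtain ⟨hw, ht, -⟩ := hIm _ hp
            obtain ⟨hw', ht', -⟩ := hIm _ hp'
            simp only [Prod.mk.injEq, g₁, g₂] at h
            have e1 := digitValue_injective (by simp only [List.length_map, hlen _ hw, hlen _ hw'])
              h.1
            rw [List.map_append, List.map_append] at e1
            have e2 := injOn_map_xd_pathsOver hROSC v v' ys hw hw' (List.append_cancel_left e1)
            simp only at e2
            subst e2
            have e3 := digitValue_injective (by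
              simp only [List.length_append, (mem_yStrings.1 ht).1, (mem_yStrings.1 ht').1]) h.2
            rw [List.append_cancel_left e3]
      _ = (I.image g₁).card * (I.image g₂).card := Finset.card_product _ _
      _ ≤ 4 * 4 := Nat.mul_le_mul h1 h2
      _ = 16 := rfl

end GDBMCarpet

namespace GDBMCarpet

section JointGrowth

variable {S : GDBMCarpet} (N : Matrix S.V S.V ℝ → ℝ)

/-- The largest norm of a product of `k` of the matrices `A_j`. -/
def maxNorm (k : ℕ) : ℝ :=
  ⨆ y : Fin k → Fin S.m, N ((List.ofFn fun i => S.Amat (y i)).prod)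

theorem le_maxNorm (ys : List (Fin S.m)) : N (ys.map S.Amat).prod ≤ maxNorm N ys.length := by
  have := le_ciSup (Set.finite_range fun y : Fin ys.length → Fin S.m =>
    N ((List.ofFn fun i => S.Amat (y i)).prod)).bddAbove ys.get
  have h : (List.ofFn fun i => S.Amat (ys.get i)) = ys.map S.Amat := by
    rw [← Function.comp_def S.Amat, ← List.map_ofFn, List.ofFn_get]
  rw [h] at this
  exact this

theorem exists_eq_maxNorm (k : ℕ) :
    ∃ ys : List (Fin S.m), ys.length = k ∧ N (ys.map S.Amat).prod = maxNorm N k := by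
  have : NeZero S.m := ⟨S.m_pos.ne'⟩
  obtain ⟨y, hy⟩ := exists_eq_ciSup_of_finite
    (f := fun y : Fin k → Fin S.m => N ((List.ofFn fun i => S.Amat (y i)).prod))
  refine ⟨List.ofFn y, List.length_ofFn, ?_⟩
  rw [List.map_ofFn]
  exact hy

variable {N}

theorem exists_matrix_norm_bounds (hN0 : ∀ A : Matrix S.V S.V ℝ, N A = 0 ↔ A = 0)
    (hNnonneg : ∀ A : Matrix S.V S.V ℝ, 0 ≤ N A)
    (hNsmul : ∀ (c : ℝ) (A : Matrix S.V S.V ℝ), N (c • A) = |c| * N A)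
    (hNadd : ∀ A B : Matrix S.V S.V ℝ, N (A + B) ≤ N A + N B) :
    (∃ C : ℝ, 0 < C ∧ ∀ A i j, A i j ≤ C * N A) ∧
      ∃ C : ℝ, 0 < C ∧ ∀ A b, 0 < b → (∀ i j, |A i j| < b) → N A < C * b := by
  obtain ⟨⟨C, hC, h1⟩, D, hD, h2⟩ := exists_norm_bounds
    (fun f : S.V × S.V → ℝ => N (Matrix.of fun i j => f (i, j)))
    (fun f => (hN0 _).trans
      ⟨fun h => funext fun p => congrFun (congrFun h p.1) p.2, fun h => by rw [h]; rfl⟩)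
    (fun f => hNnonneg _) (fun c f => hNsmul c _) (fun f g => hNadd _ _)
  refine ⟨⟨C, hC, fun A i j => (le_abs_self _).trans (h1 (fun p => A p.1 p.2) (i, j))⟩,
    D, hD, fun A b hb hA => (h2 fun p => A p.1 p.2).trans_lt ?_⟩
  exact mul_lt_mul_of_pos_left ((pi_norm_lt_iff hb).2 fun p => hA p.1 p.2) hD

theorem exists_pos_le_maxNorm [Nonempty S.V] {C : ℝ} (hC : 0 < C)
    (hCN : ∀ (A : Matrix S.V S.V ℝ) i j, A i j ≤ C * N A) (k : ℕ) : C⁻¹ ≤ maxNorm N k := by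
  obtain ⟨w, v', hw, rfl⟩ := exists_isPath_from (Classical.arbitrary S.V) k
  have h1 := hCN ((w.map S.yd).map S.Amat).prod (Classical.arbitrary S.V) v'
  rw [← card_pathsOver] at h1
  have h2 : (1 : ℝ) ≤ (S.pathsOver (Classical.arbitrary S.V) v' (w.map S.yd)).card := by
    exact_mod_cast Finset.card_pos.2 ⟨w, mem_pathsOver.2 ⟨hw, rfl⟩⟩
  have h3 := le_maxNorm N (w.map S.yd)
  rw [List.length_map] at h3
  refine le_trans ?_ h3
  rw [inv_le_iff_one_le_mul₀' hC]
  exact h2.trans h1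

theorem growth_nonneg [Nonempty S.V] {C L : ℝ} (hC : 0 < C)
    (hCN : ∀ (A : Matrix S.V S.V ℝ) i j, A i j ≤ C * N A)
    (hL : Tendsto (fun k : ℕ => 1 / (k : ℝ) * Real.log (maxNorm N k)) atTop (𝓝 L)) : 0 ≤ L := by
  have h0 : Tendsto (fun k : ℕ => 1 / (k : ℝ) * Real.log C⁻¹) atTop (𝓝 0) := by
    simpa using (tendsto_one_div_atTop_nhds_zero_nat (𝕜 := ℝ)).mul_const (Real.log C⁻¹)
  refine le_of_tendsto_of_tendsto' h0 hL fun k => ?_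
  have := Real.log_le_log (by positivity) (exists_pos_le_maxNorm hC hCN k)
  gcongr

theorem exists_card_pathsOver_le {C L t : ℝ} (hC : 0 < C)
    (hCN : ∀ (A : Matrix S.V S.V ℝ) i j, A i j ≤ C * N A)
    (hL : Tendsto (fun k : ℕ => 1 / (k : ℝ) * Real.log (maxNorm N k)) atTop (𝓝 L))
    (ht : L / Real.log S.n < t) :
    ∃ D : ℝ, 0 < D ∧ ∀ ys v v',
      ((S.pathsOver v v' ys).card : ℝ) ≤ D * ((S.n : ℝ) ^ ys.length) ^ t := by
  obtain ⟨D, hD, hDk⟩ := exists_le_rpow_of_tendsto S.one_lt_n hL ht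
  refine ⟨C * D, by positivity, fun ys v v' => ?_⟩
  rw [card_pathsOver, mul_assoc]
  exact (hCN _ _ _).trans
    (mul_le_mul_of_nonneg_left ((le_maxNorm N ys).trans (hDk _)) hC.le)

theorem eventually_exists_le_card_pathsOver [Nonempty S.V] {C D L t : ℝ} (hC : 0 < C)
    (hCN : ∀ (A : Matrix S.V S.V ℝ) i j, A i j ≤ C * N A) (hD : 0 < D)
    (hDN : ∀ (A : Matrix S.V S.V ℝ) b, 0 < b → (∀ i j, |A i j| < b) → N A < D * b)
    (hL : Tendsto (fun k : ℕ => 1 / (k : ℝ) * Real.log (maxNorm N k)) atTop (𝓝 L))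
    (ht : t < L / Real.log S.n) :
    ∀ᶠ k : ℕ in atTop, ∃ ys v v', ys.length = k ∧
      D⁻¹ * ((S.n : ℝ) ^ k) ^ t ≤ (S.pathsOver v v' ys).card := by
  have hn : (0 : ℝ) < S.n := by exact_mod_cast S.n_pos
  filter_upwards [eventually_rpow_le_of_tendsto S.one_lt_n
    (fun k => (inv_pos.2 hC).trans_le (exists_pos_le_maxNorm hC hCN k)) hL ht] with k hk
  obtain ⟨ys, hys, hN⟩ := exists_eq_maxNorm N k
  by_contra! hcon
  have := hDN (ys.map S.Amat).prod (D⁻¹ * ((S.n : ℝ) ^ k) ^ t) (by positivity) fun v v' => by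
    rw [← card_pathsOver, Nat.abs_cast]
    exact hcon ys v v' hys
  rw [hN, mul_inv_cancel_left₀ hD.ne'] at this
  linarith

end JointGrowth

section Assouad

variable {S : GDBMCarpet}

theorem assouad_upper {d s : ℝ} {C D : ℝ} (hd : 0 ≤ d) (hs : 0 ≤ s) (hC : 0 < C)
    (hCk : ∀ k, ((S.allYStrings k).card : ℝ) ≤ C * ((S.m : ℝ) ^ k) ^ d) (hD : 0 < D)
    (hDk : ∀ ys v v', ((S.pathsOver v v' ys).card : ℝ) ≤ D * ((S.n : ℝ) ^ ys.length) ^ s) :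
    ∃ B : ℝ, 0 < B ∧ ∀ x ∈ S.Xunion, ∀ r R : ℝ, 0 < r → r < R → R ≤ 1 →
      (coverNum r (S.Xunion ∩ ball x R) : ℝ) ≤ B * (R / r) ^ (d + s) := by
  have hm : (0 : ℝ) < S.m := by exact_mod_cast S.m_pos
  have hn : (0 : ℝ) < S.n := by exact_mod_cast S.n_pos
  have hm1 := S.one_lt_m
  have hn1 := S.one_lt_n
  set P : ℝ := Nat.cast (Fintype.card (S.V × S.V)) with hP
  have hP0 : 0 ≤ P := Nat.cast_nonneg _
  refine ⟨16 * (C * ((S.m : ℝ) ^ 2 * S.n) ^ d * ((P + 1) * (D * ((S.m : ℝ) ^ 2 * S.n ^ 2) ^ s))),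
    by positivity, fun x _ r R hr hrR hR => ?_⟩
  have hR0 : 0 < R := hr.trans hrR
  obtain ⟨k, hk1, hk2⟩ := exists_nat_pow_near_of_lt_one hR0 hR (inv_pos.2 hm)
    (inv_lt_one_of_one_lt₀ hm1)
  obtain ⟨K, hK1, hK2⟩ := exists_nat_pow_near_of_lt_one (x := r / S.n) (by positivity)
    ((div_le_one hn).2 (by linarith)) (inv_pos.2 hm) (inv_lt_one_of_one_lt₀ hm1)
  rw [inv_pow, inv_lt_iff_one_lt_mul₀ (by positivity)] at hk1 hK1
  rw [inv_pow, le_inv_comm₀ (by positivity) (by positivity)] at hk2 hK2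
  have hRm : R ≤ 1 / (S.m : ℝ) ^ k := by
    rw [one_div, le_inv_comm₀ hR0 (by positivity)]; exact hk2
  have hkK : k ≤ K + 1 := by
    have h1 : (S.m : ℝ) ^ k < (S.m : ℝ) ^ (K + 1) := by
      refine hk2.trans_lt ?_
      rw [inv_lt_iff_one_lt_mul₀ hR0]
      refine hK1.trans_le ?_
      rw [mul_comm]
      gcongr
      exact ((div_lt_self hr hn1).trans hrR).le
    exact ((pow_lt_pow_iff_right₀ hm1).1 h1).le
  obtain ⟨i, hi⟩ := Nat.exists_eq_add_of_le hkK
  set l := Nat.log S.n (S.m ^ k) with hl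
  set J := Nat.log S.n (S.m ^ (K + 1)) with hJ
  have hn1' : 1 < S.n := by exact_mod_cast hn1
  have hlJ : l ≤ J := Nat.log_mono_right (Nat.pow_le_pow_right S.m_pos hkK)
  obtain ⟨j, hj⟩ := Nat.exists_eq_add_of_le hlJ
  have hl1 : (S.n : ℝ) ^ l ≤ (S.m : ℝ) ^ k := by
    exact_mod_cast Nat.pow_log_le_self S.n (pow_pos S.m_pos k).ne'
  have hl2 : (S.m : ℝ) ^ k < (S.n : ℝ) ^ (l + 1) := by
    exact_mod_cast Nat.lt_pow_succ_log_self hn1' (S.m ^ k)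
  have hJ1 : (S.n : ℝ) ^ J ≤ (S.m : ℝ) ^ (K + 1) := by
    exact_mod_cast Nat.pow_log_le_self S.n (pow_pos S.m_pos (K + 1)).ne'
  have hJ2 : (S.m : ℝ) ^ (K + 1) < (S.n : ℝ) ^ (J + 1) := by
    exact_mod_cast Nat.lt_pow_succ_log_self hn1' (S.m ^ (K + 1))
  have hJK : J ≤ K + 1 := by
    have h1 : S.n ^ J ≤ S.n ^ (K + 1) :=
      (Nat.pow_log_le_self S.n (pow_pos S.m_pos (K + 1)).ne').trans
        (Nat.pow_le_pow_left S.hmn.le _)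
    exact (Nat.pow_le_pow_iff_right hn1').1 h1
  have hRn : R ≤ 1 / (S.n : ℝ) ^ l := hRm.trans (by gcongr)
  have hrm : 1 / (S.m : ℝ) ^ (k + i) ≤ r := by
    rw [← hi, div_le_iff₀ (by positivity)]
    refine hK1.le.trans ?_
    gcongr
    exact (div_lt_self hr hn1).le
  have hrn : 1 / (S.n : ℝ) ^ (l + j) ≤ r := by
    rw [← hj, div_le_iff₀ (by positivity)]
    rw [div_mul_eq_mul_div, one_lt_div hn] at hK1
    have h3 := hK1.trans (mul_lt_mul_of_pos_left hJ2 hr)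
    rw [pow_succ (S.n : ℝ), ← mul_assoc] at h3
    exact le_of_mul_le_mul_right (by linarith) hn
  have hmi : (S.m : ℝ) ^ i ≤ (S.m : ℝ) ^ 2 * S.n * (R / r) := by
    have h1 : (S.m : ℝ) ^ (k + i) ≤ S.m * (S.n / r) := by
      rw [← hi, pow_succ']
      rw [inv_div] at hK2
      gcongr
    have h2 : (S.m : ℝ) ^ i ≤ (S.m : ℝ) ^ i * (R * (S.m : ℝ) ^ (k + 1)) := by
      refine le_mul_of_one_le_right (by positivity) ?_
      rw [mul_comm]
      linarith [hk1]
    calc (S.m : ℝ) ^ i ≤ (S.m : ℝ) ^ i * (R * (S.m : ℝ) ^ (k + 1)) := h2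
      _ = (S.m : ℝ) ^ (k + i) * (R * S.m) := by ring
      _ ≤ S.m * (S.n / r) * (R * S.m) := by gcongr
      _ = _ := by ring
  have hnj : (S.n : ℝ) ^ j ≤ (S.m : ℝ) ^ 2 * S.n ^ 2 * (R / r) := by
    have h1 : (S.n : ℝ) ^ l * (S.n : ℝ) ^ j ≤ (S.n : ℝ) ^ l * (S.n * (S.m : ℝ) ^ i) := by
      calc (S.n : ℝ) ^ l * (S.n : ℝ) ^ j = (S.n : ℝ) ^ J := by rw [hj, pow_add]
        _ ≤ (S.m : ℝ) ^ k * (S.m : ℝ) ^ i := by rw [← pow_add, ← hi]; exact hJ1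
        _ ≤ (S.n : ℝ) ^ (l + 1) * (S.m : ℝ) ^ i := by gcongr
        _ = _ := by ring
    calc (S.n : ℝ) ^ j ≤ S.n * (S.m : ℝ) ^ i := le_of_mul_le_mul_left h1 (by positivity)
      _ ≤ S.n * ((S.m : ℝ) ^ 2 * S.n * (R / r)) := by gcongr
      _ = _ := by ring
  have hRr : 0 < R / r := by positivity
  have hcov := coverNum_inter_ball_le (x := x) (B := ⌊D * ((S.n : ℝ) ^ j) ^ s⌋₊)
    (by omega) hRm hRn hrm hrn
    (fun ys v v' hys => Nat.le_floor (hys ▸ hDk ys v v'))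
  calc (coverNum r (S.Xunion ∩ ball x R) : ℝ)
      ≤ 4 * (4 * ((S.allYStrings i).card * (P * (⌊D * ((S.n : ℝ) ^ j) ^ s⌋₊ : ℝ)))) := by
        have h := (Nat.cast_le (α := ℝ)).2 hcov
        push_cast at h
        simpa [hP] using h
    _ = 16 * ((S.allYStrings i).card * (P * (⌊D * ((S.n : ℝ) ^ j) ^ s⌋₊ : ℝ))) := by ring
    _ ≤ 16 * ((C * ((S.m : ℝ) ^ i) ^ d) * ((P + 1) * (D * ((S.n : ℝ) ^ j) ^ s))) := by
        have h1 : (⌊D * ((S.n : ℝ) ^ j) ^ s⌋₊ : ℝ) ≤ D * ((S.n : ℝ) ^ j) ^ s :=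
          Nat.floor_le (by positivity)
        gcongr
        · exact hCk i
        · linarith
    _ ≤ 16 * ((C * ((S.m : ℝ) ^ 2 * S.n * (R / r)) ^ d) *
          ((P + 1) * (D * ((S.m : ℝ) ^ 2 * S.n ^ 2 * (R / r)) ^ s))) := by gcongr
    _ = _ := by
        rw [Real.mul_rpow (by positivity) hRr.le, Real.mul_rpow (by positivity) hRr.le,
          Real.rpow_add hRr]
        ring

theorem assouad_lower (hROSC : S.ROSC) (hirr : S.GraphIrreducible) {d t s b C : ℝ} (hd : 0 ≤ d)
    (hdk : ∀ k, ((S.m : ℝ) ^ k) ^ d ≤ (S.allYStrings k).card) (hb : 0 < b)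
    (ht : ∀ᶠ k : ℕ in atTop, ∃ ys v v', ys.length = k ∧
      b * ((S.n : ℝ) ^ k) ^ t ≤ (S.pathsOver v v' ys).card)
    (hs : 0 ≤ s) (hC : 0 < C)
    (hCs : ∀ x ∈ S.Xunion, ∀ r R : ℝ, 0 < r → r < R → R ≤ 1 →
      (coverNum r (S.Xunion ∩ ball x R) : ℝ) ≤ C * (R / r) ^ s) : d + t ≤ s := by
  have hm : (0 : ℝ) < S.m := by exact_mod_cast S.m_pos
  have hn : (0 : ℝ) < S.n := by exact_mod_cast S.n_pos
  have hm1 := S.one_lt_m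
  have hn1 := S.one_lt_n
  have hmn : (S.m : ℝ) < S.n := by exact_mod_cast S.hmn
  obtain ⟨Q, hQ⟩ := exists_card_allYStrings_le hirr
  refine le_of_eventually_mul_rpow_le (c := b * ((S.m : ℝ) ^ d)⁻¹)
    (C := Q * (16 * (C * (2 * S.n) ^ s))) hn1 (by positivity) ?_
  filter_upwards [ht, eventually_gt_atTop 0] with j ⟨ys, v, v', hys, hle⟩ hj
  have hne : (S.pathsOver v v' ys).Nonempty := by
    have : 0 < b * ((S.n : ℝ) ^ j) ^ t := by positivity
    exact Finset.card_pos.1 (by exact_mod_cast this.trans_le hle)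
  have hex : ∃ l, S.m ^ (l + j) ≤ S.n ^ l := by
    obtain ⟨l, hl⟩ := pow_unbounded_of_one_lt ((S.m : ℝ) ^ j) ((one_lt_div hm).2 hmn)
    rw [div_pow, lt_div_iff₀ (by positivity), mul_comm, ← pow_add] at hl
    exact ⟨l, by exact_mod_cast hl.le⟩
  obtain ⟨l, hl, hlmin⟩ : ∃ l, S.m ^ (l + j) ≤ S.n ^ l ∧ ∀ l' < l, S.n ^ l' < S.m ^ (l' + j) :=
    ⟨Nat.find hex, Nat.find_spec hex, fun l' h => not_le.1 (Nat.find_min hex h)⟩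
  set k := l + j with hk
  have hnl1 : (S.m : ℝ) ^ k ≤ (S.n : ℝ) ^ l := by exact_mod_cast hl
  have hnl2 : (S.n : ℝ) ^ l ≤ S.n * (S.m : ℝ) ^ k := by
    rcases l.eq_zero_or_pos with h0 | h0
    · rw [h0, pow_zero]
      have : (1 : ℝ) ≤ (S.m : ℝ) ^ k := one_le_pow₀ hm1.le
      nlinarith
    · obtain ⟨l', rfl⟩ := Nat.exists_eq_succ_of_ne_zero h0.ne'
      have h1 : (S.n : ℝ) ^ l' < (S.m : ℝ) ^ (l' + j) := by exact_mod_cast hlmin l' (by omega)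
      have h2 : (S.m : ℝ) ^ (l' + j) ≤ (S.m : ℝ) ^ k := pow_le_pow_right₀ hm1.le (by omega)
      rw [Nat.succ_eq_add_one, pow_succ']
      gcongr
      linarith
  set K := Nat.log S.m (S.n ^ k) with hK
  have hm1' : 1 < S.m := by exact_mod_cast hm1
  have hkK : k ≤ K := Nat.le_log_of_pow_le hm1' (Nat.pow_le_pow_left S.hmn.le k)
  obtain ⟨i, hi⟩ := Nat.exists_eq_add_of_le hkK
  have hK1 : (S.m : ℝ) ^ (k + i) ≤ (S.n : ℝ) ^ k := by
    rw [← hi]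
    exact_mod_cast Nat.pow_log_le_self S.m (pow_pos S.n_pos k).ne'
  have hK2 : (S.n : ℝ) ^ k < (S.m : ℝ) ^ (k + i + 1) := by
    rw [← hi]
    exact_mod_cast Nat.lt_pow_succ_log_self hm1' (S.n ^ k)
  obtain ⟨x, hx, hcard⟩ := exists_card_mul_card_le_coverNum hROSC hirr (i := i)
    (r := 1 / (S.n : ℝ) ^ k) hne (by rw [hys]) hnl1 (by positivity) le_rfl (by gcongr)
  have hmk : (0 : ℝ) < (S.m : ℝ) ^ k := by positivity
  have hnk : (0 : ℝ) < (S.n : ℝ) ^ k := by positivity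
  have hrR : 1 / (S.n : ℝ) ^ k < 2 / (S.m : ℝ) ^ k := by
    have h1 : (S.m : ℝ) ^ k ≤ (S.n : ℝ) ^ k := pow_le_pow_left₀ hm.le hmn.le k
    rw [div_lt_div_iff₀ hnk hmk]
    linarith
  have hR1 : 2 / (S.m : ℝ) ^ k ≤ 1 := by
    rw [div_le_one hmk]
    have h1 : (2 : ℝ) ≤ S.m := by exact_mod_cast S.hm
    exact h1.trans (le_self_pow₀ hm1.le (by omega))
  have hcov := hCs x hx _ _ (by positivity) hrR hR1
  have hratio : 2 / (S.m : ℝ) ^ k / (1 / (S.n : ℝ) ^ k) ≤ 2 * S.n * (S.n : ℝ) ^ j := by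
    rw [div_div_div_eq, mul_one, div_le_iff₀ hmk]
    calc 2 * (S.n : ℝ) ^ k = 2 * ((S.n : ℝ) ^ l * (S.n : ℝ) ^ j) := by rw [hk, pow_add]
      _ ≤ 2 * (S.n * (S.m : ℝ) ^ k * (S.n : ℝ) ^ j) := by gcongr
      _ = _ := by ring
  have hnj : (S.n : ℝ) ^ j ≤ S.m * (S.m : ℝ) ^ i := by
    have h1 : (S.m : ℝ) ^ k * (S.n : ℝ) ^ j ≤ (S.m : ℝ) ^ k * (S.m * (S.m : ℝ) ^ i) := by
      calc (S.m : ℝ) ^ k * (S.n : ℝ) ^ j ≤ (S.n : ℝ) ^ l * (S.n : ℝ) ^ j := by gcongr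
        _ = (S.n : ℝ) ^ k := by rw [hk, pow_add]
        _ ≤ (S.m : ℝ) ^ (k + i + 1) := hK2.le
        _ = _ := by ring
    exact le_of_mul_le_mul_left h1 hmk
  calc b * ((S.m : ℝ) ^ d)⁻¹ * ((S.n : ℝ) ^ j) ^ (d + t)
      = b * ((S.n : ℝ) ^ j) ^ t * (((S.m : ℝ) ^ d)⁻¹ * ((S.n : ℝ) ^ j) ^ d) := by
        rw [Real.rpow_add (by positivity)]; ring
    _ ≤ b * ((S.n : ℝ) ^ j) ^ t * (((S.m : ℝ) ^ d)⁻¹ * (S.m * (S.m : ℝ) ^ i) ^ d) := by gcongr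
    _ = b * ((S.n : ℝ) ^ j) ^ t * ((S.m : ℝ) ^ i) ^ d := by
        rw [Real.mul_rpow hm.le (by positivity), inv_mul_cancel_left₀ (by positivity)]
    _ ≤ (S.pathsOver v v' ys).card * (Q * (S.yStrings v' i).card) := by
        gcongr
        exact (hdk i).trans (by exact_mod_cast hQ v' i)
    _ = Q * ((S.pathsOver v v' ys).card * (S.yStrings v' i).card) := by ring
    _ ≤ Q * (16 * coverNum (1 / (S.n : ℝ) ^ k) (S.Xunion ∩ ball x (2 / (S.m : ℝ) ^ k))) := by
        refine mul_le_mul_of_nonneg_left ?_ (Nat.cast_nonneg Q)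
        have := (Nat.cast_le (α := ℝ)).2 hcard
        push_cast at this
        exact this
    _ ≤ Q * (16 * (C * (2 * S.n * (S.n : ℝ) ^ j) ^ s)) := by
        gcongr
        refine hcov.trans ?_
        gcongr
    _ = _ := by rw [Real.mul_rpow (by positivity) (by positivity)]; ring

end Assouad

end GDBMCarpet

/-- **Corollary 1.2.** Assume ROSC holds and the adjacency matrix `A` is irreducible.
Then `dim_A X = dim_B π(X) + (1/log n) · lim_{k→∞} (1/k) log max_{y₁,…,y_k} ‖A_{y₁}⋯A_{y_k}‖`,
where `‖·‖` is any matrix norm. -/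
theorem assouadDim_matrix_formula (S : GDBMCarpet)
    (hROSC : S.ROSC) (hirr : S.GraphIrreducible)
    (N : Matrix S.V S.V ℝ → ℝ)
    (hN0 : ∀ A : Matrix S.V S.V ℝ, N A = 0 ↔ A = 0)
    (hNnonneg : ∀ A : Matrix S.V S.V ℝ, 0 ≤ N A)
    (hNsmul : ∀ (c : ℝ) (A : Matrix S.V S.V ℝ), N (c • A) = |c| * N A)
    (hNadd : ∀ A B : Matrix S.V S.V ℝ, N (A + B) ≤ N A + N B)
    (L : ℝ)
    (hL : Filter.Tendsto
      (fun k : ℕ => (1 / (k : ℝ)) *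
        Real.log (⨆ y : Fin k → Fin S.m, N ((List.ofFn (fun i => S.Amat (y i))).prod)))
      Filter.atTop (nhds L)) :
    assouadDim S.Xunion = boxDim (Prod.snd '' S.Xunion) + L / Real.log S.n := by
  rcases isEmpty_or_nonempty S.V with hV | hV
  · have hX : S.Xunion = ∅ := Set.iUnion_of_empty _
    have hc : ∀ r : ℝ, coverNum r (∅ : Set ℝ) = 0 := fun r =>
      Nat.le_zero.1 (coverNum_le_card (∅ : Finset ℝ) (Set.empty_subset _))
    have hN : ∀ A : Matrix S.V S.V ℝ, N A = 0 := fun A => (hN0 A).2 (Subsingleton.elim _ _)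
    have hL0 : L = 0 := tendsto_nhds_unique hL (by simp [hN])
    have hset : {s : ℝ | 0 ≤ s ∧ ∃ C : ℝ, 0 < C ∧ ∀ x ∈ (∅ : Set (ℝ × ℝ)), ∀ r R : ℝ,
        0 < r → r < R → R ≤ 1 →
        (coverNum r (∅ ∩ Metric.ball x R) : ℝ) ≤ C * (R / r) ^ s} = Set.Ici 0 := by
      ext s
      exact ⟨fun h => h.1, fun h => ⟨h, 1, one_pos, fun x hx => hx.elim⟩⟩
    rw [hX, hL0, Set.image_empty, assouadDim, hset, csInf_Ici]
    simp [boxDim, upperBoxDim, hc]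
  · have hL' : Tendsto (fun k : ℕ => 1 / (k : ℝ) * Real.log (GDBMCarpet.maxNorm N k))
        atTop (𝓝 L) := hL
    obtain ⟨⟨C, hC, hCN⟩, D, hD, hDN⟩ :=
      GDBMCarpet.exists_matrix_norm_bounds hN0 hNnonneg hNsmul hNadd
    obtain ⟨h, hh, hlim, hle⟩ := S.exists_tendsto_log_card_allYStrings
    rw [GDBMCarpet.boxDim_snd_Xunion hh hlim hle]
    have hlogm : 0 < Real.log S.m := Real.log_pos S.one_lt_m
    have hlogn : 0 < Real.log S.n := Real.log_pos S.one_lt_n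
    have hd0 : 0 ≤ h / Real.log S.m := by positivity
    have hl0 : 0 ≤ L / Real.log S.n := div_nonneg (GDBMCarpet.growth_nonneg hC hCN hL') hlogn.le
    have hm : (0 : ℝ) < S.m := by exact_mod_cast S.m_pos
    have hdk : ∀ k, ((S.m : ℝ) ^ k) ^ (h / Real.log S.m) ≤ (S.allYStrings k).card := by
      intro k
      have hpos : (0 : ℝ) < (S.allYStrings k).card := by
        exact_mod_cast GDBMCarpet.card_allYStrings_pos k
      rw [← Real.log_le_log_iff (by positivity) hpos, Real.log_rpow (by positivity), Real.log_pow]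
      refine le_trans (le_of_eq ?_) (hle k)
      field_simp
    have hmem : ∀ ε : ℝ, 0 < ε → h / Real.log S.m + L / Real.log S.n + ε ∈
        {s : ℝ | 0 ≤ s ∧ ∃ C : ℝ, 0 < C ∧ ∀ x ∈ S.Xunion, ∀ r R : ℝ,
          0 < r → r < R → R ≤ 1 →
          (coverNum r (S.Xunion ∩ Metric.ball x R) : ℝ) ≤ C * (R / r) ^ s} := by
      intro ε hε
      obtain ⟨C₁, hC₁, h₁⟩ := exists_le_rpow_of_tendsto S.one_lt_m hlim
        (show h / Real.log S.m < h / Real.log S.m + ε / 2 by linarith)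
      obtain ⟨C₂, hC₂, h₂⟩ := GDBMCarpet.exists_card_pathsOver_le hC hCN hL'
        (show L / Real.log S.n < L / Real.log S.n + ε / 2 by linarith)
      have := GDBMCarpet.assouad_upper (by linarith) (by linarith) hC₁ h₁ hC₂ h₂
      rw [show h / Real.log S.m + ε / 2 + (L / Real.log S.n + ε / 2) =
        h / Real.log S.m + L / Real.log S.n + ε by ring] at this
      exact ⟨by linarith, this⟩
    refine le_antisymm (le_of_forall_pos_le_add fun ε hε => ?_) ?_
    · exact csInf_le ⟨0, fun s hs => hs.1⟩ (hmem ε hε)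
    · refine le_csInf ⟨_, hmem 1 one_pos⟩ ?_
      rintro s ⟨hs, B, hB, hBs⟩
      refine le_of_forall_pos_le_add fun ε hε => ?_
      have := GDBMCarpet.assouad_lower hROSC hirr hd0 hdk (inv_pos.2 hD)
        (GDBMCarpet.eventually_exists_le_card_pathsOver hC hCN hD hDN hL'
          (show L / Real.log S.n - ε < L / Real.log S.n by linarith)) hs hB hBs
      linarith
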